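/- Let f ∈ E_rad and let φ ∈ Φ_rad be nonzero. Then f^{*φ} ∈ Eq(f); in particular |f^{*φ}|_{L^p(ℝ⁶)} = |f|_{L^p(ℝ⁶)} for every p ∈ [1,∞]. Moreover f^{*φ} ∈ E_rad and there is a universal constant C > 0 such that ∫_{ℝ⁶} |v|² f^{*φ}(x,v) dx dv ≤ C |∇φ|^{4/3}_{L²(ℝ³)} |f|^{7/9}_{L¹(ℝ⁶)} |f|^{2/9}_{L∞(ℝ⁶)}. -/

import Mathlib

noncomputable section

open MeasureTheory Real Filter Set Topology
open scoped ENNReal NNReal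

abbrev E3 : Type := EuclideanSpace ℝ (Fin 3)
abbrev Phase : Type := E3 × E3

/-- Spherical symmetry: invariance under all rotations of `ℝ³` acting jointly on `x` and `v`. -/
def SphSym (f : Phase → ℝ) : Prop :=
  ∀ R : E3 ≃ₗᵢ[ℝ] E3, LinearMap.det (R.toLinearEquiv : E3 →ₗ[ℝ] E3) = 1 →
    ∀ z : Phase, f (R z.1, R z.2) = f z

/-- `|x × v|²`, via the Lagrange identity. -/
def ellOf (z : Phase) : ℝ := ‖z.1‖ ^ 2 * ‖z.2‖ ^ 2 - (inner ℝ z.1 z.2 : ℝ) ^ 2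

/-- Spatial density. -/
def rhoF (f : Phase → ℝ) (x : E3) : ℝ := ∫ v : E3, f (x, v)

/-- Poisson field. -/
def phiF (f : Phase → ℝ) (x : E3) : ℝ := - ∫ y : E3, rhoF f y / (4 * π * ‖x - y‖)

/-- Radial representation of the Poisson field. -/
def phiRad (f : Phase → ℝ) (r : ℝ) : ℝ :=
  phiF f (r • (EuclideanSpace.single (0 : Fin 3) (1:ℝ)))

def mass (f : Phase → ℝ) : ℝ := ∫ z : Phase, f z

def kineticE (f : Phase → ℝ) : ℝ := ∫ z : Phase, ‖z.2‖ ^ 2 * f z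

def gradPhi (f : Phase → ℝ) (x : E3) : E3 := gradient (phiF f) x

def fieldSq (f : Phase → ℝ) : ℝ := ∫ x : E3, ‖gradPhi f x‖ ^ 2

/-- `L²` distance between the force fields of `f` and `g`. -/
def fieldDist (f g : Phase → ℝ) : ℝ :=
  Real.sqrt (∫ x : E3, ‖gradPhi f x - gradPhi g x‖ ^ 2)

/-- The Hamiltonian. -/
def Ham (f : Phase → ℝ) : ℝ := kineticE f / 2 - fieldSq f / 2

/-- The norm of the energy space. -/
def eNormE (f : Phase → ℝ) : ℝ≥0∞ :=
  eLpNorm f 1 volume + eLpNorm f ⊤ volume +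
    ∫⁻ z : Phase, (‖z.2‖₊ : ℝ≥0∞) ^ 2 * (‖f z‖₊ : ℝ≥0∞)

def memE (f : Phase → ℝ) : Prop := Measurable f ∧ (∀ z, 0 ≤ f z) ∧ eNormE f < ⊤

def memErad (f : Phase → ℝ) : Prop := memE f ∧ SphSym f

/-- Density of the measure `ν_ℓ`. -/
def nuDens (ℓ : ℝ) (p : ℝ × ℝ) : ℝ≥0∞ :=
  if 0 < p.1 ∧ ℓ < p.1 ^ 2 * p.2 ^ 2 then
    ENNReal.ofReal (4 * π ^ 2 * p.1 * |p.2| / Real.sqrt (p.1 ^ 2 * p.2 ^ 2 - ℓ))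
  else 0

def nuMeas (ℓ : ℝ) : Measure (ℝ × ℝ) := volume.withDensity (nuDens ℓ)

/-- Representative phase point with `|x| = r`, `|v| = |u|`, `|x×v|² = ℓ` and
`x·v = sign u · √(r²u²-ℓ)`. -/
def radPoint (r u ℓ : ℝ) : Phase :=
  (r • (EuclideanSpace.single (0 : Fin 3) (1:ℝ)),
   (Real.sign u * Real.sqrt (r ^ 2 * u ^ 2 - ℓ) / r) • (EuclideanSpace.single (0 : Fin 3) (1:ℝ))
     + (Real.sqrt ℓ / r) • (EuclideanSpace.single (1 : Fin 3) (1:ℝ)))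

/-- Distribution function of `f` at kinetic momentum `ℓ`. -/
def muDist (f : Phase → ℝ) (s ℓ : ℝ) : ℝ≥0∞ :=
  nuMeas ℓ {p : ℝ × ℝ | s < f (radPoint p.1 p.2 ℓ)}

/-- `g ∈ Eq(f)` : `g` is nonnegative, spherically symmetric and equimeasurable to `f`
at (almost) every kinetic momentum `ℓ`. -/
def EqMeas (f g : Phase → ℝ) : Prop :=
  (∀ z, 0 ≤ g z) ∧ SphSym g ∧
    ∀ s : ℝ, 0 < s →
      ∀ᵐ ℓ ∂(volume.restrict (Ioi (0:ℝ))), muDist g s ℓ = muDist f s ℓ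

/-- Schwarz symmetrization of `f` at fixed `ℓ`. -/
def schwarz (f : Phase → ℝ) (t ℓ : ℝ) : ℝ :=
  if ENNReal.ofReal t < muDist f 0 ℓ then
    sSup {s : ℝ | 0 ≤ s ∧ ENNReal.ofReal t < muDist f s ℓ}
  else 0

/-- Effective potential. -/
def psiPot (φ : ℝ → ℝ) (ℓ r : ℝ) : ℝ := φ r + ℓ / (2 * r ^ 2)

def eMinPot (φ : ℝ → ℝ) (ℓ : ℝ) : ℝ := sInf (psiPot φ ℓ '' Ioi 0)

def r1Pot (φ : ℝ → ℝ) (e ℓ : ℝ) : ℝ := sInf {r : ℝ | 0 < r ∧ psiPot φ ℓ r < e}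

def r2Pot (φ : ℝ → ℝ) (e ℓ : ℝ) : ℝ := sSup {r : ℝ | 0 < r ∧ psiPot φ ℓ r < e}

/-- The Jacobian `a_φ(e, ℓ)` (meaningful for `e < 0`). -/
def aPot (φ : ℝ → ℝ) (e ℓ : ℝ) : ℝ :=
  8 * π ^ 2 * Real.sqrt 2 * ∫ r in Ioi (0:ℝ), Real.sqrt (max (e - psiPot φ ℓ r) 0)

/-- Inverse of the bijection `e ↦ a_φ(e,ℓ)` from `(e_{φ,ℓ},0)` onto `(0,∞)`. -/
def aPotInv (φ : ℝ → ℝ) (s ℓ : ℝ) : ℝ :=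
  sSup {e : ℝ | eMinPot φ ℓ < e ∧ e < 0 ∧ aPot φ e ℓ < s}

/-- Microscopic energy w.r.t. the Poisson field of `g`. -/
def microE (g : Phase → ℝ) (z : Phase) : ℝ := ‖z.2‖ ^ 2 / 2 + phiF g z.1

/-- Rearrangement of `f` with respect to the microscopic energy of the field of `g`. -/
def rearr (f g : Phase → ℝ) (z : Phase) : ℝ :=
  if microE g z < 0 then
    schwarz f (aPot (phiRad g) (microE g z) (ellOf z)) (ellOf z)
  else 0

/-- Assumption (A). -/
structure AssumptionA (Q : Phase → ℝ) (F : ℝ → ℝ → ℝ) (e₀ : ℝ) : Prop where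
  contQ : Continuous Q
  nonneg : ∀ z, 0 ≤ Q z
  nonzero : Q ≠ 0
  cpt : HasCompactSupport Q
  sph : SphSym Q
  eqF : ∀ z : Phase, Q z = F (microE Q z) (ellOf z)
  Fnonneg : ∀ e ℓ, 0 ≤ ℓ → 0 ≤ F e ℓ
  Fcont : ContinuousOn (fun p : ℝ × ℝ => F p.1 p.2) {p : ℝ × ℝ | 0 ≤ p.2}
  e₀neg : e₀ < 0
  Fsupp : ∀ e ℓ, 0 ≤ ℓ → 0 < F e ℓ → e < e₀
  FC1 : ContDiffOn ℝ 1 (fun p : ℝ × ℝ => F p.1 p.2) {p : ℝ × ℝ | 0 ≤ p.2 ∧ 0 < F p.1 p.2}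
  FeNeg : ∀ e ℓ, 0 ≤ ℓ → 0 < F e ℓ → deriv (fun e' => F e' ℓ) e < 0

/-- The reduced functional `J_{f^*}(φ_g) = H(f^{*φ_g}) + ½|∇φ_g − ∇φ_{f^{*φ_g}}|²`. -/
def Jred (f g : Phase → ℝ) : ℝ :=
  Ham (rearr f g) + (∫ x : E3, ‖gradPhi g x - gradPhi (rearr f g) x‖ ^ 2) / 2

def distL1 (f g : Phase → ℝ) : ℝ := ∫ z : Phase, |f z - g z|

def distL1v (f g : Phase → ℝ) : ℝ := ∫ z : Phase, ‖z.2‖ ^ 2 * |f z - g z|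


abbrev bv (i : Fin 3) : E3 := EuclideanSpace.single i (1:ℝ)

def IsRot (R : E3 ≃ₗᵢ[ℝ] E3) : Prop := LinearMap.det (R.toLinearEquiv : E3 →ₗ[ℝ] E3) = 1

lemma exists_rot (b : OrthonormalBasis (Fin 3) ℝ E3) :
    ∃ R : E3 ≃ₗᵢ[ℝ] E3, IsRot R ∧ R (b 0) = bv 0 ∧ R (b 1) = bv 1 := by
  have h0 : b.repr (b 0) = bv 0 := by simp
  have h1 : b.repr (b 1) = bv 1 := by simp
  have hd : |LinearMap.det (b.repr.toLinearEquiv : E3 →ₗ[ℝ] E3)| = 1 := by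
    have := LinearMap.normDet_eq_norm_det (b.repr.toLinearEquiv : E3 →ₗ[ℝ] E3)
    rw [Real.norm_eq_abs] at this
    rw [← this]
    exact LinearIsometry.normDet_eq_one b.repr.toLinearIsometry
  rcases (abs_eq (by norm_num)).1 hd with h | h
  · exact ⟨b.repr, h, h0, h1⟩
  · let K : Submodule ℝ E3 := (ℝ ∙ (bv 2))ᗮ
    have hK : LinearMap.det (K.reflection.toLinearEquiv : E3 →ₗ[ℝ] E3) = -1 := by
      have := Submodule.det_reflection (K := K)
      rw [Submodule.orthogonal_orthogonal, finrank_span_singleton (by simp)] at this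
      simpa using this
    have hm : ∀ i : Fin 3, i ≠ 2 → bv i ∈ K := by
      intro i hi
      rw [Submodule.mem_orthogonal_singleton_iff_inner_right]
      simp [EuclideanSpace.inner_single_left, hi.symm]
    refine ⟨b.repr.trans K.reflection, ?_, ?_, ?_⟩
    · unfold IsRot
      have : ((b.repr.trans K.reflection).toLinearEquiv : E3 →ₗ[ℝ] E3) =
        (K.reflection.toLinearEquiv : E3 →ₗ[ℝ] E3) ∘ₗ (b.repr.toLinearEquiv : E3 →ₗ[ℝ] E3) := rfl
      rw [this, LinearMap.det_comp, hK, h]; norm_num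
    · rw [LinearIsometryEquiv.trans_apply, h0]
      exact Submodule.reflection_mem_subspace_eq_self (hm 0 (by decide))
    · rw [LinearIsometryEquiv.trans_apply, h1]
      exact Submodule.reflection_mem_subspace_eq_self (hm 1 (by decide))

def canon (r a ℓ : ℝ) : Phase := (r • bv 0, a • bv 0 + (√ℓ / r) • bv 1)

lemma ellOf_eq (x v : E3) (hx : x ≠ 0) :
    ellOf (x, v) = ‖x‖ ^ 2 * ‖v - (inner ℝ x v / ‖x‖ ^ 2) • x‖ ^ 2 := by
  have hx' : ‖x‖ ≠ 0 := norm_ne_zero_iff.2 hx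
  unfold ellOf
  simp only
  rw [norm_sub_sq_real, norm_smul, inner_smul_right, real_inner_comm, Real.norm_eq_abs, mul_pow,
    sq_abs]
  field_simp
  ring

lemma exists_rot_canon (x v : E3) (hx : x ≠ 0) :
    ∃ R : E3 ≃ₗᵢ[ℝ] E3, IsRot R ∧
      (R x, R v) = canon ‖x‖ (inner ℝ x v / ‖x‖) (ellOf (x, v)) := by
  have hx' : ‖x‖ ≠ 0 := norm_ne_zero_iff.2 hx
  set w := v - (inner ℝ x v / ‖x‖ ^ 2) • x with hw
  have hxw : inner ℝ x w = (0:ℝ) := by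
    rw [hw, inner_sub_right, inner_smul_right, real_inner_self_eq_norm_sq]
    field_simp; ring
  have hv : v = (inner ℝ x v / ‖x‖ ^ 2) • x + w := by rw [hw]; abel
  have hl : √(ellOf (x, v)) / ‖x‖ = ‖w‖ := by
    rw [ellOf_eq x v hx, ← hw, ← mul_pow, Real.sqrt_sq (by positivity)]
    field_simp
  have key : ∀ R : E3 ≃ₗᵢ[ℝ] E3, R x = ‖x‖ • bv 0 → R w = ‖w‖ • bv 1 →
      (R x, R v) = canon ‖x‖ (inner ℝ x v / ‖x‖) (ellOf (x, v)) := by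
    intro R h0 h1
    unfold canon
    rw [hl, h0]
    congr 1
    conv_lhs => rw [hv]
    rw [map_add, map_smul, h0, h1, smul_smul]
    congr 2
    field_simp
  by_cases hw0 : w = 0
  · obtain ⟨b, hb⟩ := Orthonormal.exists_orthonormalBasis_extension_of_card_eq (𝕜 := ℝ) (E := E3)
      (ι := Fin 3) (by simp) (v := fun _ => (‖x‖⁻¹) • x) (s := {0}) (by
        refine ⟨fun i => ?_, fun i j hij => ?_⟩
        · simp [norm_smul, hx']
        · exact absurd (Subsingleton.elim i j) hij)
    obtain ⟨R, hR, h0, h1⟩ := exists_rot b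
    refine ⟨R, hR, key R ?_ (by simp [hw0])⟩
    rw [hb 0 rfl, map_smul] at h0
    rw [← h0, smul_smul, mul_inv_cancel₀ hx', one_smul]
  · have hw' : ‖w‖ ≠ 0 := norm_ne_zero_iff.2 hw0
    obtain ⟨b, hb⟩ := Orthonormal.exists_orthonormalBasis_extension_of_card_eq (𝕜 := ℝ) (E := E3)
      (ι := Fin 3) (by simp) (v := fun i => if i = 0 then (‖x‖⁻¹) • x else (‖w‖⁻¹) • w)
      (s := {0, 1}) (by
        refine ⟨fun i => ?_, ?_⟩
        · rcases i with ⟨i, rfl | rfl⟩ <;> simp [norm_smul, hx', hw']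
        · rintro ⟨i, rfl | rfl⟩ ⟨j, rfl | rfl⟩ hij <;>
            simp [inner_smul_left, inner_smul_right, hxw, real_inner_comm] at hij ⊢
          )
    obtain ⟨R, hR, h0, h1⟩ := exists_rot b
    refine ⟨R, hR, key R ?_ ?_⟩
    · rw [hb 0 (by simp), if_pos rfl, map_smul] at h0
      rw [← h0, smul_smul, mul_inv_cancel₀ hx', one_smul]
    · rw [hb 1 (by simp), if_neg (by simp), map_smul] at h1
      rw [← h1, smul_smul, mul_inv_cancel₀ hw', one_smul]

lemma ellOf_nonneg (z : Phase) : 0 ≤ ellOf z := by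
  unfold ellOf
  have := abs_real_inner_le_norm z.1 z.2
  have h2 := sq_le_sq' (by linarith [neg_abs_le (inner ℝ z.1 z.2 : ℝ), this]) ((le_abs_self _).trans this)
  nlinarith

lemma lint_sq (G : ℝ → ℝ≥0∞) :
    ∫⁻ t in Ioi (0:ℝ), G t = ∫⁻ r in Ioi (0:ℝ), ENNReal.ofReal (2 * r) * G (r ^ 2) := by
  have him : (fun r : ℝ => r ^ 2) '' Ioi 0 = Ioi 0 := by
    ext t
    constructor
    · rintro ⟨r, hr, rfl⟩; exact pow_pos (mem_Ioi.1 hr) 2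
    · intro ht; exact ⟨√t, Real.sqrt_pos.2 ht, Real.sq_sqrt (le_of_lt ht)⟩
  have := lintegral_image_eq_lintegral_abs_deriv_mul (s := Ioi (0:ℝ)) (f := fun r : ℝ => r ^ 2)
    (f' := fun r => 2 * r) measurableSet_Ioi
    (fun x _ => by simpa using (hasDerivAt_pow 2 x).hasDerivWithinAt)
    (fun a ha b hb h => by
      exact (pow_left_inj₀ (le_of_lt ha) (le_of_lt hb) two_ne_zero).1 h) G
  rw [him] at this
  rw [this]
  refine setLIntegral_congr_fun measurableSet_Ioi fun r hr => ?_
  rw [abs_of_pos (by have := mem_Ioi.1 hr; positivity)]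

lemma lint_two (G : ℝ → ℝ≥0∞) (hG : Measurable G) :
    ∫⁻ p : ℝ × ℝ, G (p.1 ^ 2 + p.2 ^ 2) = ENNReal.ofReal π * ∫⁻ t in Ioi (0:ℝ), G t := by
  rw [← lintegral_comp_polarCoord_symm]
  have h1 : ∀ p : ℝ × ℝ, (polarCoord.symm p).1 ^ 2 + (polarCoord.symm p).2 ^ 2 = p.1 ^ 2 := by
    intro p
    simp only [polarCoord_symm_apply]
    nlinarith [Real.sin_sq_add_cos_sq p.2]
  simp_rw [h1, smul_eq_mul]
  have : polarCoord.target = Ioi (0:ℝ) ×ˢ Ioo (-π) π := rfl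
  rw [this, Measure.volume_eq_prod, ← Measure.prod_restrict, lintegral_prod _ (by fun_prop), lint_sq G]
  simp only [lintegral_const, Measure.restrict_apply MeasurableSet.univ, univ_inter, Real.volume_Ioo]
  rw [← lintegral_const_mul _ (by fun_prop)]
  refine setLIntegral_congr_fun measurableSet_Ioi fun r hr => ?_
  have hr := mem_Ioi.1 hr
  rw [mul_comm (_ * _), ← mul_assoc, ← mul_assoc, ← ENNReal.ofReal_mul (by linarith [Real.pi_pos]),
    ← ENNReal.ofReal_mul (by positivity)]
  congr 2
  ring

lemma lint_three (F : ℝ → ℝ → ℝ≥0∞) (hF : Measurable (Function.uncurry F)) :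
    ∫⁻ v : E3, F (v 0) (v 1 ^ 2 + v 2 ^ 2) =
      ENNReal.ofReal π * ∫⁻ a, ∫⁻ t in Ioi (0:ℝ), F a t := by
  have e1 := (PiLp.volume_preserving_ofLp (Fin 3))
  have e2 := volume_preserving_piFinSuccAbove (fun _ : Fin 3 => ℝ) 0
  have e3 := (MeasurePreserving.id (volume : Measure ℝ)).prod (volume_preserving_finTwoArrow ℝ)
  have e := e3.comp (e2.comp e1)
  have hm : Measurable (fun q : ℝ × ℝ × ℝ => F q.1 (q.2.1 ^ 2 + q.2.2 ^ 2)) :=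
    hF.comp (f := fun q : ℝ × ℝ × ℝ => (q.1, q.2.1 ^ 2 + q.2.2 ^ 2)) (by fun_prop)
  have := e.lintegral_comp hm
  have h2 : ∫⁻ v : E3, F (v 0) (v 1 ^ 2 + v 2 ^ 2) =
      ∫⁻ q : ℝ × ℝ × ℝ, F q.1 (q.2.1 ^ 2 + q.2.2 ^ 2) := by
    rw [Measure.volume_eq_prod, Measure.volume_eq_prod] at *
    rw [← this]
    rfl
  rw [h2, Measure.volume_eq_prod, lintegral_prod _ hm.aemeasurable]
  have h3 : ∀ a : ℝ, Measurable (F a) := fun a => hF.comp measurable_prodMk_left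
  simp_rw [lint_two _ (h3 _)]
  rw [lintegral_const_mul _ hF.lintegral_prod_right]

lemma normsq_three (v : E3) : ‖v‖ ^ 2 = v 0 ^ 2 + (v 1 ^ 2 + v 2 ^ 2) := by
  rw [EuclideanSpace.norm_sq_eq, Fin.sum_univ_three]
  simp [sq_abs, add_assoc]

lemma lint_shell (F : ℝ → ℝ → ℝ≥0∞) (hF : Measurable (Function.uncurry F)) :
    ∫⁻ v : E3, F (v 0) (‖v‖ ^ 2) =
      ENNReal.ofReal π * ∫⁻ s in Ioi (0:ℝ), ENNReal.ofReal (2 * s) *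
        ∫⁻ a in Ioo (-s) s, F a (s ^ 2) := by
  have h0 : ∀ v : E3, F (v 0) (‖v‖ ^ 2) =
      (fun a t => F a (a ^ 2 + t)) (v 0) (v 1 ^ 2 + v 2 ^ 2) := by
    intro v; rw [normsq_three]
  rw [lintegral_congr h0]
  rw [lint_three (fun a t => F a (a ^ 2 + t)) (hF.comp (f := fun q : ℝ × ℝ => (q.1, q.1 ^ 2 + q.2)) (by fun_prop))]
  congr 1
  have h1 : ∀ a : ℝ, ∫⁻ t in Ioi (0:ℝ), F a (a ^ 2 + t) =
      ∫⁻ t in Ioi (0:ℝ), (if a ^ 2 < t then F a t else 0) := by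
    intro a
    have e := lintegral_add_left_eq_self (μ := (volume : Measure ℝ))
      (fun t => if a ^ 2 < t then F a t else 0) (a ^ 2)
    rw [← lintegral_indicator measurableSet_Ioi, ← lintegral_indicator measurableSet_Ioi]
    have : ∀ t, (Ioi (0:ℝ)).indicator (fun t => if a ^ 2 < t then F a t else 0) t =
        if a ^ 2 < t then F a t else 0 := by
      intro t
      by_cases ht : 0 < t
      · simp [indicator, ht]
      · have : ¬ (a ^ 2 < t) := fun h => ht (lt_of_le_of_lt (sq_nonneg a) h)
        simp [indicator, ht, this]
    simp_rw [this]
    rw [← e]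
    congr 1
    ext t
    simp [indicator]
  simp_rw [h1]
  have hm : Measurable (fun q : ℝ × ℝ => if q.1 ^ 2 < q.2 then F q.1 q.2 else 0) :=
    Measurable.ite (measurableSet_lt (by fun_prop) (by fun_prop)) hF measurable_const
  rw [lintegral_lintegral_swap (f := fun a t => if a ^ 2 < t then F a t else 0) hm.aemeasurable,
    lint_sq]
  refine setLIntegral_congr_fun measurableSet_Ioi fun s hs => ?_
  have hs := mem_Ioi.1 hs
  congr 1
  rw [← lintegral_indicator measurableSet_Ioo]
  congr 1
  ext a
  have : a ^ 2 < s ^ 2 ↔ a ∈ Ioo (-s) s := by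
    rw [sq_lt_sq, abs_of_pos hs, abs_lt]; rfl
  simp only [indicator, this]

lemma lint_rad (G : ℝ → ℝ≥0∞) (hG : Measurable G) :
    ∫⁻ x : E3, G ‖x‖ = ENNReal.ofReal (4 * π) * ∫⁻ s in Ioi (0:ℝ), ENNReal.ofReal (s ^ 2) * G s := by
  have h := lint_shell (fun _ t => G (√t)) (by
    exact hG.comp (f := fun q : ℝ × ℝ => √q.2) (by fun_prop))
  have h0 : ∀ v : E3, √(‖v‖ ^ 2) = ‖v‖ := fun v => Real.sqrt_sq (norm_nonneg _)
  simp_rw [h0] at h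
  have h1 : ∫⁻ s in Ioi (0:ℝ), ENNReal.ofReal (2 * s) * ∫⁻ _ in Ioo (-s) s, G (√(s ^ 2)) =
      ∫⁻ s in Ioi (0:ℝ), ENNReal.ofReal 4 * (ENNReal.ofReal (s ^ 2) * G s) := by
    refine setLIntegral_congr_fun measurableSet_Ioi fun s hs => ?_
    have hs := mem_Ioi.1 hs
    simp only [Real.sqrt_sq hs.le, lintegral_const, Measure.restrict_apply MeasurableSet.univ,
      univ_inter, Real.volume_Ioo]
    rw [mul_comm (G s), ← mul_assoc, ← mul_assoc, ← ENNReal.ofReal_mul (by positivity),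
      ← ENNReal.ofReal_mul (by positivity)]
    congr 2
    ring
  rw [h, h1, lintegral_const_mul _ (by fun_prop), ← mul_assoc, ← ENNReal.ofReal_mul (by positivity)]
  congr 2
  ring

lemma lint_even (W : ℝ → ℝ≥0∞) (hW : Measurable W) :
    ∫⁻ u, W u = ∫⁻ u in Ioi (0:ℝ), (W u + W (-u)) := by
  rw [lintegral_add_left hW, ← lintegral_add_compl W (measurableSet_Ioi (a := (0:ℝ)))]
  congr 1
  have h := (Measure.measurePreserving_neg (volume : Measure ℝ)).setLIntegral_comp_preimage
    (measurableSet_Iio (a := (0:ℝ))) hW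
  have h2 : (Neg.neg ⁻¹' Iio (0:ℝ)) = Ioi 0 := by ext; simp
  rw [h2] at h
  rw [h, compl_Ioi]
  exact setLIntegral_congr Iio_ae_eq_Iic.symm

lemma nuDens_meas : Measurable (fun q : ℝ × ℝ × ℝ => nuDens q.1 q.2) := by
  unfold nuDens
  have h1 : MeasurableSet {q : ℝ × ℝ × ℝ | 0 < q.2.1} :=
    measurableSet_lt (by fun_prop) (by fun_prop)
  have h2 : MeasurableSet {q : ℝ × ℝ × ℝ | q.1 < q.2.1 ^ 2 * q.2.2 ^ 2} :=
    measurableSet_lt (by fun_prop) (by fun_prop)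
  exact Measurable.ite (h1.inter h2) (by fun_prop) measurable_const

lemma nu_subst (r ℓ : ℝ) (hr : 0 < r) (hl : 0 ≤ ℓ) (H : ℝ → ℝ≥0∞) (hH : Measurable H) :
    ∫⁻ u, nuDens ℓ (r, u) * H (Real.sign u * √(r ^ 2 * u ^ 2 - ℓ) / r) =
      ENNReal.ofReal (4 * π ^ 2) * ∫⁻ a, H a := by
  have hsg : Measurable Real.sign := by
    unfold Real.sign
    refine Measurable.ite measurableSet_Iio measurable_const
      (Measurable.ite measurableSet_Ioi measurable_const measurable_const)
  have hnu : Measurable fun u => nuDens ℓ (r, u) :=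
    nuDens_meas.comp (f := fun u => (ℓ, r, u)) (by fun_prop)
  rw [lint_even _ (by
    refine hnu.mul (hH.comp ?_)
    exact ((hsg.mul (by fun_prop)).div_const _)), lint_even H hH,
    ← lintegral_const_mul _ (by fun_prop)]
  set c := √ℓ / r with hc
  have hc0 : 0 ≤ c := by positivity
  have hcl : r ^ 2 * c ^ 2 = ℓ := by
    rw [hc, div_pow, Real.sq_sqrt hl]; field_simp
  have hiff : ∀ u, 0 < u → (ℓ < r ^ 2 * u ^ 2 ↔ c < u) := by
    intro u hu
    rw [← hcl, mul_lt_mul_iff_right₀ (by positivity), sq_lt_sq₀ hc0 hu.le]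
  set k : ℝ → ℝ := fun u => √(r ^ 2 * u ^ 2 - ℓ) / r with hk
  have him : k '' Ioi c = Ioi 0 := by
    ext t
    constructor
    · rintro ⟨u, hu, rfl⟩
      have hu := mem_Ioi.1 hu
      have := (hiff u (hc0.trans_lt hu)).2 hu
      exact div_pos (Real.sqrt_pos.2 (by linarith)) hr
    · intro ht
      have ht := mem_Ioi.1 ht
      have h2 : r ^ 2 * (√(t ^ 2 + c ^ 2)) ^ 2 - ℓ = (r * t) ^ 2 := by
        rw [Real.sq_sqrt (by positivity), ← hcl]; ring
      refine ⟨√(t ^ 2 + c ^ 2), ?_, ?_⟩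
      · exact Real.lt_sqrt_of_sq_lt (by nlinarith)
      · simp only [hk, h2]
        rw [Real.sqrt_sq (by positivity)]; field_simp
  have hder : ∀ u ∈ Ioi c, HasDerivWithinAt k (r * u / √(r ^ 2 * u ^ 2 - ℓ)) (Ioi c) u := by
    intro u hu
    have hu := mem_Ioi.1 hu
    have hp : 0 < r ^ 2 * u ^ 2 - ℓ := by
      have := (hiff u (hc0.trans_lt hu)).2 hu
      linarith
    have h1 : HasDerivAt (fun u : ℝ => r ^ 2 * u ^ 2 - ℓ) (r ^ 2 * (2 * u)) u := by
      simpa using ((hasDerivAt_pow 2 u).const_mul (r ^ 2)).sub_const ℓ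
    have h2 := (h1.sqrt hp.ne').div_const r
    refine (h2.congr_deriv ?_).hasDerivWithinAt
    have := Real.sqrt_pos.2 hp
    field_simp
  have hinj : InjOn k (Ioi c) := by
    intro u hu u' hu' h
    have hu := mem_Ioi.1 hu
    have hu' := mem_Ioi.1 hu'
    have hp := (hiff u (hc0.trans_lt hu)).2 hu
    have hp' := (hiff u' (hc0.trans_lt hu')).2 hu'
    simp only [hk] at h
    have h := (div_left_inj' hr.ne').1 h
    have h := (Real.sqrt_inj (by linarith) (by linarith)).1 h
    have h : u ^ 2 = u' ^ 2 := by
      have : r ^ 2 * u ^ 2 = r ^ 2 * u' ^ 2 := by linarith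
      exact mul_left_cancel₀ (by positivity) this
    exact (pow_left_inj₀ (hc0.trans hu.le) (hc0.trans hu'.le) two_ne_zero).1 h
  have key := lintegral_image_eq_lintegral_abs_deriv_mul measurableSet_Ioi hder hinj
    (fun a => ENNReal.ofReal (4 * π ^ 2) * (H a + H (-a)))
  rw [him] at key
  rw [key, ← lintegral_indicator measurableSet_Ioi, ← lintegral_indicator measurableSet_Ioi]
  congr 1
  ext u
  by_cases hu0 : 0 < u
  · by_cases hu : c < u
    · have hp := (hiff u hu0).2 hu
      have hp2 := Real.sqrt_pos.2 (sub_pos.2 hp)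
      have hn1 : nuDens ℓ (r, u) = ENNReal.ofReal (4 * π ^ 2 * r * |u| / √(r ^ 2 * u ^ 2 - ℓ)) := by
        simp [nuDens, hr, hp]
      have hn2 : nuDens ℓ (r, -u) = ENNReal.ofReal (4 * π ^ 2 * r * |u| / √(r ^ 2 * u ^ 2 - ℓ)) := by
        simp [nuDens, hr, hp]
      simp only [indicator, mem_Ioi, hu0, hu, if_true, hn1, hn2, Real.sign_of_pos hu0,
        Real.sign_of_neg (neg_neg_of_pos hu0), neg_sq, hk, one_mul, neg_mul, neg_div]
      rw [← mul_add, ← mul_assoc, ← ENNReal.ofReal_mul (abs_nonneg _), abs_of_pos hu0,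
        abs_of_pos (by positivity)]
      congr 2
      field_simp
    · have hp : ¬ (ℓ < r ^ 2 * u ^ 2) := fun h => hu ((hiff u hu0).1 h)
      have hn1 : nuDens ℓ (r, u) = 0 := by simp [nuDens, hp]
      have hn2 : nuDens ℓ (r, -u) = 0 := by simp [nuDens, hp]
      simp [indicator, hu, hn1, hn2]
  · have hu : ¬ c < u := fun h => hu0 (hc0.trans_lt h)
    simp [indicator, hu0, hu]

lemma canon_meas : Measurable (fun q : ℝ × ℝ × ℝ => canon q.1 q.2.1 q.2.2) := by
  unfold canon; fun_prop

lemma muDist_eq (h : Phase → ℝ) (hh : Measurable h) (s ℓ : ℝ) (hl : 0 ≤ ℓ) :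
    muDist h s ℓ = ENNReal.ofReal (4 * π ^ 2) *
      volume {p : ℝ × ℝ | 0 < p.1 ∧ s < h (canon p.1 p.2 ℓ)} := by
  have hsg : Measurable Real.sign := by
    unfold Real.sign
    refine Measurable.ite measurableSet_Iio measurable_const
      (Measurable.ite measurableSet_Ioi measurable_const measurable_const)
  have hrp : Measurable (fun p : ℝ × ℝ => radPoint p.1 p.2 ℓ) := by
    unfold radPoint
    have : Measurable (fun p : ℝ × ℝ => Real.sign p.2) := hsg.comp measurable_snd
    fun_prop
  have hc : ∀ r u, radPoint r u ℓ = canon r (Real.sign u * √(r ^ 2 * u ^ 2 - ℓ) / r) ℓ := by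
    intro r u; rfl
  have hcm : Measurable (fun p : ℝ × ℝ => canon p.1 p.2 ℓ) :=
    canon_meas.comp (f := fun p : ℝ × ℝ => (p.1, p.2, ℓ)) (by fun_prop)
  have hS : MeasurableSet {p : ℝ × ℝ | s < h (radPoint p.1 p.2 ℓ)} :=
    measurableSet_lt measurable_const (hh.comp hrp)
  have hT : MeasurableSet {p : ℝ × ℝ | 0 < p.1 ∧ s < h (canon p.1 p.2 ℓ)} :=
    (measurableSet_lt measurable_const measurable_fst).inter
      (measurableSet_lt measurable_const (hh.comp hcm))
  have hnu : Measurable (nuDens ℓ) :=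
    nuDens_meas.comp (f := fun p : ℝ × ℝ => (ℓ, p)) (by fun_prop)
  unfold muDist nuMeas
  rw [withDensity_apply _ hS, ← lintegral_indicator hS, ← lintegral_indicator_one hT,
    Measure.volume_eq_prod, lintegral_prod _ (hnu.indicator hS).aemeasurable,
    lintegral_prod _ ((measurable_one.indicator hT).aemeasurable),
    ← lintegral_const_mul _ (measurable_one.indicator hT).lintegral_prod_right']
  congr 1
  ext r
  by_cases hr : 0 < r
  · have := nu_subst r ℓ hr hl (fun a => {a | s < h (canon r a ℓ)}.indicator 1 a) (by
      refine measurable_one.indicator (measurableSet_lt measurable_const ?_)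
      exact hh.comp (hcm.comp (f := fun a : ℝ => (r, a)) (by fun_prop)))
    refine Eq.trans (lintegral_congr fun u => ?_) (this.trans ?_)
    · simp only [indicator, mem_ofPred_eq, hc]
      split_ifs <;> simp
    · congr 1
      refine lintegral_congr fun a => ?_
      simp [indicator, hr]
  · have hz : ∀ u, nuDens ℓ (r, u) = 0 := by intro u; simp [nuDens, hr]
    simp [indicator, hz, hr]

lemma ellOf_canon (r a ℓ : ℝ) (hr : 0 < r) (hl : 0 ≤ ℓ) : ellOf (canon r a ℓ) = ℓ := by
  unfold ellOf canon
  have h1 : ‖a • bv 0 + (√ℓ / r) • bv 1‖ ^ 2 = a ^ 2 + ℓ / r ^ 2 := by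
    rw [normsq_three]
    simp [div_pow, Real.sq_sqrt hl]
  have h2 : (inner ℝ (r • bv 0) (a • bv 0 + (√ℓ / r) • bv 1) : ℝ) = r * a := by
    simp [inner_smul_left, EuclideanSpace.inner_single_left]
  simp only [h1, h2, norm_smul]
  simp
  field_simp
  ring

lemma canon_snd_sq (r a ℓ : ℝ) (hl : 0 ≤ ℓ) : ‖(canon r a ℓ).2‖ ^ 2 = a ^ 2 + ℓ / r ^ 2 := by
  unfold canon
  rw [normsq_three]
  simp [div_pow, Real.sq_sqrt hl]

lemma lint_scale (G : ℝ → ℝ≥0∞) (c : ℝ) (hc : 0 < c) (hG : Measurable G) :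
    ENNReal.ofReal c * ∫⁻ t in Ioi (0:ℝ), G (c * t) = ∫⁻ t in Ioi (0:ℝ), G t := by
  have him : (fun t : ℝ => c * t) '' Ioi 0 = Ioi 0 := by
    ext t
    constructor
    · rintro ⟨r, hr, rfl⟩; exact mul_pos hc hr
    · intro ht
      have ht := mem_Ioi.1 ht
      exact ⟨t / c, mem_Ioi.2 (by positivity), by field_simp⟩
  have := lintegral_image_eq_lintegral_abs_deriv_mul (s := Ioi (0:ℝ)) (f := fun r : ℝ => c * r)
    (f' := fun _ => c) measurableSet_Ioi
    (fun x _ => by simpa using ((hasDerivAt_id x).const_mul c).hasDerivWithinAt)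
    (fun a ha b hb h => mul_left_cancel₀ hc.ne' h) G
  rw [him] at this
  rw [this, abs_of_pos hc, lintegral_const_mul _ (by fun_prop)]

lemma sph_canon (h : Phase → ℝ) (hs : SphSym h) (x v : E3) (hx : x ≠ 0) :
    h (x, v) = h (canon ‖x‖ (inner ℝ x v / ‖x‖) (ellOf (x, v))) := by
  obtain ⟨R, hR, h1⟩ := exists_rot_canon x v hx
  rw [← h1, hs R hR (x, v)]

lemma exists_rot_norm (x : E3) : ∃ R : E3 ≃ₗᵢ[ℝ] E3, IsRot R ∧ R x = ‖x‖ • bv 0 := by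
  by_cases hx : x = 0
  · refine ⟨LinearIsometryEquiv.refl ℝ E3, ?_, by simp [hx]⟩
    unfold IsRot
    exact LinearMap.det_id
  · obtain ⟨R, hR, h1⟩ := exists_rot_canon x x hx
    exact ⟨R, hR, congrArg Prod.fst h1⟩

lemma lint_rad_of (K : E3 → ℝ≥0∞) (hK : Measurable K)
    (hR : ∀ R : E3 ≃ₗᵢ[ℝ] E3, IsRot R → ∀ x, K (R x) = K x) :
    ∫⁻ x, K x = ENNReal.ofReal (4 * π) *
      ∫⁻ s in Ioi (0:ℝ), ENNReal.ofReal (s ^ 2) * K (s • bv 0) := by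
  have h1 : ∀ x, K x = (fun s : ℝ => K (s • bv 0)) ‖x‖ := by
    intro x
    obtain ⟨R, hR1, h⟩ := exists_rot_norm x
    simp only
    rw [← h, hR R hR1]
  have h2 : Measurable (fun s : ℝ => K (s • bv 0)) :=
    hK.comp (f := fun s : ℝ => s • bv 0) (by fun_prop)
  rw [lintegral_congr h1, lint_rad _ h2]

lemma vol_eq (h : Phase → ℝ) (hh : Measurable h) (hs : SphSym h) (s : ℝ) :
    volume {z | s < h z} = ∫⁻ ℓ in Ioi (0:ℝ), muDist h s ℓ := by
  have hA : MeasurableSet {z | s < h z} := measurableSet_lt measurable_const hh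
  set I : Phase → ℝ≥0∞ := {z | s < h z}.indicator 1 with hI
  have hIm : Measurable I := measurable_one.indicator hA
  have hIe : ∀ z z', h z = h z' → I z = I z' := by
    intro z z' e; simp [hI, indicator, e]
  rw [← lintegral_indicator_one hA, Measure.volume_eq_prod, lintegral_prod _ hIm.aemeasurable,
    lint_rad_of _ hIm.lintegral_prod_right']
  swap
  · intro R hR x
    have e := R.measurePreserving.lintegral_comp (f := fun v => I (R x, v)) (by fun_prop)
    rw [← e]
    exact lintegral_congr fun v => hIe _ _ (hs R hR (x, v))
  have h1 : ∫⁻ r in Ioi (0:ℝ), ENNReal.ofReal (r ^ 2) * ∫⁻ v, I (r • bv 0, v) =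
      ∫⁻ r in Ioi (0:ℝ), ENNReal.ofReal π *
        ∫⁻ a, ∫⁻ ℓ in Ioi (0:ℝ), I (canon r a ℓ) := by
    refine setLIntegral_congr_fun measurableSet_Ioi fun r hr => ?_
    have hr := mem_Ioi.1 hr
    have hcm : Measurable (fun q : ℝ × ℝ => I (canon r q.1 q.2)) :=
      hIm.comp (canon_meas.comp (f := fun q : ℝ × ℝ => (r, q.1, q.2)) (by fun_prop))
    have e1 : ∀ v : E3, I (r • bv 0, v) =
        (fun a t => I (canon r a (r ^ 2 * t))) (v 0) (v 1 ^ 2 + v 2 ^ 2) := by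
      intro v
      apply hIe
      have hn : ‖r • bv 0‖ = r := by simp [norm_smul, abs_of_pos hr]
      have hin : (inner ℝ (r • bv 0) v : ℝ) = r * v 0 := by
        simp [inner_smul_left, EuclideanSpace.inner_single_left]
      have he : ellOf (r • bv 0, v) = r ^ 2 * (v 1 ^ 2 + v 2 ^ 2) := by
        unfold ellOf
        simp only [hn, hin, normsq_three v]
        ring
      have h0 : r • bv 0 ≠ 0 := by
        rw [← norm_ne_zero_iff, hn]; exact hr.ne'
      rw [sph_canon h hs _ v h0, hn, hin, he]
      congr 2
      field_simp
    have hcm2 : Measurable (Function.uncurry fun a t => I (canon r a (r ^ 2 * t))) :=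
      hcm.comp (f := fun q : ℝ × ℝ => (q.1, r ^ 2 * q.2)) (by fun_prop)
    rw [lintegral_congr e1, lint_three _ hcm2, mul_left_comm,
      ← lintegral_const_mul _ hcm2.lintegral_prod_right]
    congr 1
    refine lintegral_congr fun a => ?_
    exact lint_scale (fun ℓ => I (canon r a ℓ)) (r ^ 2) (by positivity)
      (hcm.comp (f := fun ℓ : ℝ => (a, ℓ)) (by fun_prop))
  have hcm3 : Measurable (fun q : (ℝ × ℝ) × ℝ => I (canon q.1.1 q.1.2 q.2)) :=
    hIm.comp (canon_meas.comp (f := fun q : (ℝ × ℝ) × ℝ => (q.1.1, q.1.2, q.2)) (by fun_prop))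
  have hm4 : Measurable (fun p : ℝ × ℝ => ∫⁻ ℓ in Ioi (0:ℝ), I (canon p.1 p.2 ℓ)) :=
    hcm3.lintegral_prod_right'
  rw [h1, lintegral_const_mul _ hm4.lintegral_prod_right', ← mul_assoc,
    ← ENNReal.ofReal_mul (by positivity), ← lintegral_prod _ hm4.aemeasurable,
    lintegral_lintegral_swap (f := fun (p : ℝ × ℝ) (ℓ : ℝ) => I (canon p.1 p.2 ℓ))
      hcm3.aemeasurable,
    ← lintegral_const_mul _ hcm3.lintegral_prod_left']
  refine setLIntegral_congr_fun measurableSet_Ioi fun ℓ hℓ => ?_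
  simp only
  rw [muDist_eq h hh s ℓ (le_of_lt hℓ)]
  congr 1
  · congr 1; ring
  have hcm : Measurable (fun p : ℝ × ℝ => canon p.1 p.2 ℓ) :=
    canon_meas.comp (f := fun p : ℝ × ℝ => (p.1, p.2, ℓ)) (by fun_prop)
  have hS : MeasurableSet {p : ℝ × ℝ | s < h (canon p.1 p.2 ℓ)} :=
    measurableSet_lt measurable_const (hh.comp hcm)
  have e2 : (fun p : ℝ × ℝ => I (canon p.1 p.2 ℓ)) =
      {p : ℝ × ℝ | s < h (canon p.1 p.2 ℓ)}.indicator 1 := by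
    ext p; simp [hI, indicator]
  rw [e2, lintegral_indicator_one hS]
  have e3 : (volume.restrict (Ioi (0:ℝ))).prod (volume : Measure ℝ) =
      (volume : Measure (ℝ × ℝ)).restrict (Ioi 0 ×ˢ univ) := by
    rw [Measure.volume_eq_prod, ← Measure.prod_restrict, Measure.restrict_univ]
  rw [e3, Measure.restrict_apply hS]
  congr 1
  ext p
  simp [and_comm]

lemma muDist_meas (h : Phase → ℝ) (hh : Measurable h) (s : ℝ) :
    Measurable (fun ℓ => muDist h s ℓ) := by
  have hsg : Measurable Real.sign := by
    unfold Real.sign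
    refine Measurable.ite measurableSet_Iio measurable_const
      (Measurable.ite measurableSet_Ioi measurable_const measurable_const)
  have hrp : Measurable (fun q : ℝ × ℝ × ℝ => radPoint q.2.1 q.2.2 q.1) := by
    unfold radPoint
    have : Measurable (fun p : ℝ × ℝ × ℝ => Real.sign p.2.2) := hsg.comp (by fun_prop)
    fun_prop
  have hS : MeasurableSet {q : ℝ × ℝ × ℝ | s < h (radPoint q.2.1 q.2.2 q.1)} :=
    measurableSet_lt measurable_const (hh.comp hrp)
  have : (fun ℓ => muDist h s ℓ) = fun ℓ => ∫⁻ p : ℝ × ℝ,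
      {q : ℝ × ℝ × ℝ | s < h (radPoint q.2.1 q.2.2 q.1)}.indicator
        (fun q => nuDens q.1 q.2) (ℓ, p) := by
    ext ℓ
    unfold muDist nuMeas
    have hS1 : MeasurableSet {p : ℝ × ℝ | s < h (radPoint p.1 p.2 ℓ)} :=
      measurable_prodMk_left (x := ℓ) hS
    rw [withDensity_apply _ hS1, ← lintegral_indicator hS1]
    rfl
  rw [this]
  exact (nuDens_meas.indicator hS).lintegral_prod_right'

lemma muDist_anti (f : Phase → ℝ) (ℓ : ℝ) {s s' : ℝ} (h : s ≤ s') :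
    muDist f s' ℓ ≤ muDist f s ℓ :=
  measure_mono fun _ hp => lt_of_le_of_lt h hp

/-- measurability of the Schwarz symmetrization -/
lemma schwarz_meas (f : Phase → ℝ) (hf : Measurable f) :
    Measurable (fun q : ℝ × ℝ => schwarz f q.1 q.2) := by
  have hm : ∀ s, Measurable fun q : ℝ × ℝ => muDist f s q.2 := fun s =>
    (muDist_meas f hf s).comp measurable_snd
  have hset : ∀ s, MeasurableSet {q : ℝ × ℝ | ENNReal.ofReal q.1 < muDist f s q.2} := fun s =>
    measurableSet_lt (by fun_prop) (hm s)
  unfold schwarz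
  refine Measurable.ite (hset 0) ?_ measurable_const
  have key : (fun q : ℝ × ℝ => sSup {s : ℝ | 0 ≤ s ∧ ENNReal.ofReal q.1 < muDist f s q.2}) =
      fun q => ⨆ n : ℚ, (if 0 ≤ (n:ℝ) ∧ ENNReal.ofReal q.1 < muDist f n q.2 then (n:ℝ) else 0) := by
    ext q
    set S : Set ℝ := {s : ℝ | 0 ≤ s ∧ ENNReal.ofReal q.1 < muDist f s q.2} with hS
    set T : ℚ → ℝ := fun n =>
      if 0 ≤ (n:ℝ) ∧ ENNReal.ofReal q.1 < muDist f n q.2 then (n:ℝ) else 0 with hT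
    have hdown : ∀ s ∈ S, ∀ n : ℚ, 0 ≤ (n:ℝ) → (n:ℝ) ≤ s → T n = n := by
      intro s hs n h0 h1
      have : 0 ≤ (n:ℝ) ∧ ENNReal.ofReal q.1 < muDist f n q.2 :=
        ⟨h0, hs.2.trans_le (muDist_anti f _ h1)⟩
      simp only [hT, if_pos this]
    have hTS : ∀ n, T n = 0 ∨ T n ∈ S := by
      intro n
      by_cases h : 0 ≤ (n:ℝ) ∧ ENNReal.ofReal q.1 < muDist f n q.2
      · right; simp only [hT, if_pos h]; exact h
      · left; simp only [hT, if_neg h]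
    have hT0 : ∀ n, 0 ≤ T n := by
      intro n
      rcases hTS n with h | h
      · rw [h]
      · exact h.1
    have hST : ∀ b, 0 ≤ b → (∀ n, T n ≤ b) → ∀ s ∈ S, s ≤ b := by
      intro b hb hn s hs
      by_contra hlt
      push Not at hlt
      obtain ⟨n, hn1, hn2⟩ := exists_rat_btwn hlt
      have := hdown s hs n (hb.trans hn1.le) hn2.le
      have h2 := hn n
      rw [this] at h2
      linarith
    by_cases hb : BddAbove (range T)
    · have h0 : (0:ℝ) ≤ ⨆ n, T n := Real.iSup_nonneg hT0
      have hle := hST _ h0 (fun n => le_ciSup hb n)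
      apply le_antisymm
      · exact Real.sSup_le hle h0
      · refine ciSup_le fun n => ?_
        rcases hTS n with h | h
        · rw [h]; exact Real.sSup_nonneg fun s hs => hs.1
        · exact le_csSup ⟨_, hle⟩ h
    · have hb2 : ¬ BddAbove S := by
        rintro ⟨b, hb'⟩
        apply hb
        refine ⟨max b 0, ?_⟩
        rintro _ ⟨n, rfl⟩
        rcases hTS n with h | h
        · rw [h]; exact le_max_right _ _
        · exact (hb' h).trans (le_max_left _ _)
      rw [Real.sSup_of_not_bddAbove hb2, Real.iSup_of_not_bddAbove hb]
  rw [key]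
  refine Measurable.iSup fun n => ?_
  refine Measurable.ite ?_ measurable_const measurable_const
  exact (MeasurableSet.const _).inter (hset n)

lemma schwarz_nonneg (f : Phase → ℝ) (t ℓ : ℝ) : 0 ≤ schwarz f t ℓ := by
  unfold schwarz
  split_ifs
  · exact Real.sSup_nonneg fun s hs => hs.1
  · exact le_rfl

lemma lt_schwarz_iff (f : Phase → ℝ) (t ℓ s s₀ : ℝ) (h0 : muDist f s₀ ℓ = 0) (hs : 0 ≤ s) :
    s < schwarz f t ℓ ↔ ENNReal.ofReal t < muDist f s ℓ := by
  constructor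
  · intro h
    unfold schwarz at h
    split_ifs at h with h1
    · have hne : {s : ℝ | 0 ≤ s ∧ ENNReal.ofReal t < muDist f s ℓ}.Nonempty := ⟨0, le_rfl, h1⟩
      obtain ⟨s', hs', h2⟩ := exists_lt_of_lt_csSup hne h
      exact hs'.2.trans_le (muDist_anti f ℓ h2.le)
    · linarith
  · intro h
    have h1 : ENNReal.ofReal t < muDist f 0 ℓ := h.trans_le (muDist_anti f ℓ hs)
    unfold schwarz
    rw [if_pos h1]
    have hun : {p : ℝ × ℝ | s < f (radPoint p.1 p.2 ℓ)} =
        ⋃ n : ℕ, {p : ℝ × ℝ | s + 1 / ((n:ℝ) + 1) < f (radPoint p.1 p.2 ℓ)} := by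
      ext p
      simp only [mem_ofPred_eq, mem_iUnion]
      constructor
      · intro hp
        obtain ⟨n, hn⟩ := exists_nat_one_div_lt (sub_pos.2 hp)
        exact ⟨n, by linarith⟩
      · rintro ⟨n, hn⟩
        have : (0:ℝ) < 1 / ((n:ℝ) + 1) := by positivity
        linarith
    have hmono : Monotone fun n : ℕ => {p : ℝ × ℝ | s + 1 / ((n:ℝ) + 1) < f (radPoint p.1 p.2 ℓ)} := by
      intro n m hnm p hp
      simp only [mem_ofPred_eq] at hp ⊢
      have : 1 / ((m:ℝ) + 1) ≤ 1 / ((n:ℝ) + 1) := by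
        apply one_div_le_one_div_of_le (by positivity)
        have : (n:ℝ) ≤ m := by exact_mod_cast hnm
        linarith
      linarith
    have h2 := h
    unfold muDist at h2
    rw [hun, hmono.measure_iUnion] at h2
    obtain ⟨n, hn⟩ := lt_iSup_iff.1 h2
    have hpos : (0:ℝ) < 1 / ((n:ℝ) + 1) := by positivity
    have hmem : s + 1 / ((n:ℝ) + 1) ∈ {s : ℝ | 0 ≤ s ∧ ENNReal.ofReal t < muDist f s ℓ} :=
      ⟨by linarith, hn⟩
    have hbd : BddAbove {s : ℝ | 0 ≤ s ∧ ENNReal.ofReal t < muDist f s ℓ} := by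
      refine ⟨s₀, fun s' hs' => ?_⟩
      by_contra hlt
      push Not at hlt
      have := hs'.2.trans_le (muDist_anti f ℓ hlt.le)
      rw [h0] at this
      exact absurd this (by simp)
    exact lt_of_lt_of_le (by linarith) (le_csSup hbd hmem)

section PotSec

structure GoodPot (φ : ℝ → ℝ) (B c R : ℝ) : Prop where
  meas : Measurable φ
  hB : 0 ≤ B
  hc : 0 < c
  hR : 0 < R
  low : ∀ r, 0 < r → -B / r ≤ φ r
  up : ∀ r, R ≤ r → φ r ≤ -c / r

variable {φ : ℝ → ℝ} {B c R : ℝ}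

lemma psi_low (h : GoodPot φ B c R) {ℓ : ℝ} (hl : 0 < ℓ) {r : ℝ} (hr : 0 < r) :
    -B ^ 2 / (2 * ℓ) ≤ psiPot φ ℓ r := by
  have h1 := h.low r hr
  unfold psiPot
  have : -B / r + ℓ / (2 * r ^ 2) + B ^ 2 / (2 * ℓ) = (ℓ / r - B) ^ 2 / (2 * ℓ) := by
    field_simp; ring
  have h2 : 0 ≤ (ℓ / r - B) ^ 2 / (2 * ℓ) := by positivity
  rw [neg_div]
  linarith

lemma psi_meas (h : GoodPot φ B c R) (ℓ : ℝ) : Measurable (psiPot φ ℓ) := by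
  unfold psiPot
  have := h.meas
  fun_prop

def domF (B ℓ e : ℝ) (r : ℝ) : ℝ := (Ioc 0 (B / (-e))).indicator (fun _ => √(B ^ 2 / (2 * ℓ))) r

lemma le_domF (h : GoodPot φ B c R) {ℓ : ℝ} (hl : 0 < ℓ) {e e' r : ℝ} (he : e' ≤ e) (he0 : e < 0)
    (hr : 0 < r) : √(max (e' - psiPot φ ℓ r) 0) ≤ domF B ℓ e r := by
  unfold domF
  by_cases hm : r ≤ B / (-e)
  · rw [indicator_of_mem (show r ∈ Ioc 0 (B / (-e)) from ⟨hr, hm⟩)]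
    apply Real.sqrt_le_sqrt
    have := psi_low h hl hr
    rw [neg_div] at this
    exact max_le (by linarith) (by positivity)
  · rw [indicator_of_notMem (fun hh => hm hh.2)]
    have h1 : e' - psiPot φ ℓ r ≤ 0 := by
      push Not at hm
      rw [div_lt_iff₀ (by linarith)] at hm
      have h1 := h.low r hr
      have h2 : 0 < ℓ / (2 * r ^ 2) := by positivity
      have h3 : e ≤ -B / r := by
        rw [le_div_iff₀ hr]; linarith
      unfold psiPot
      linarith
    rw [max_eq_right h1, Real.sqrt_zero]

lemma domF_int (B ℓ e : ℝ) : Integrable (domF B ℓ e) (volume.restrict (Ioi (0:ℝ))) := by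
  apply Integrable.integrableOn
  unfold domF
  rw [integrable_indicator_iff measurableSet_Ioc]
  exact integrableOn_const (by simp)

lemma aInt_int (h : GoodPot φ B c R) {ℓ : ℝ} (hl : 0 < ℓ) {e : ℝ} (he : e < 0) :
    Integrable (fun r => √(max (e - psiPot φ ℓ r) 0)) (volume.restrict (Ioi (0:ℝ))) := by
  refine (domF_int B ℓ e).mono' ?_ ?_
  · have := psi_meas h ℓ
    exact Measurable.aestronglyMeasurable (by fun_prop)
  · filter_upwards [self_mem_ae_restrict measurableSet_Ioi] with r hr
    rw [Real.norm_eq_abs, abs_of_nonneg (Real.sqrt_nonneg _)]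
    exact le_domF h hl le_rfl he hr

lemma aPot_nonneg (φ : ℝ → ℝ) (e ℓ : ℝ) : 0 ≤ aPot φ e ℓ := by
  unfold aPot
  have : 0 ≤ ∫ r in Ioi (0:ℝ), √(max (e - psiPot φ ℓ r) 0) :=
    integral_nonneg fun r => Real.sqrt_nonneg _
  positivity

lemma aPot_mono (h : GoodPot φ B c R) {ℓ : ℝ} (hl : 0 < ℓ) {e e' : ℝ} (hee : e ≤ e') (he : e' < 0) :
    aPot φ e ℓ ≤ aPot φ e' ℓ := by
  unfold aPot
  refine mul_le_mul_of_nonneg_left ?_ (by positivity)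
  refine integral_mono (aInt_int h hl (hee.trans_lt he)) (aInt_int h hl he) fun r => ?_
  exact Real.sqrt_le_sqrt (max_le_max (by linarith) le_rfl)

lemma aPot_cont (h : GoodPot φ B c R) {ℓ : ℝ} (hl : 0 < ℓ) :
    ContinuousOn (fun e => aPot φ e ℓ) (Iio 0) := by
  intro e he
  have he : e < 0 := he
  apply ContinuousAt.continuousWithinAt
  unfold aPot
  refine ContinuousAt.mul continuousAt_const ?_
  have hpm := psi_meas h ℓ
  have hev : ∀ᶠ e' in 𝓝 e, e' ≤ e / 2 := by
    filter_upwards [Iio_mem_nhds (show e < e / 2 by linarith)] with x hx using le_of_lt hx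
  refine continuousAt_of_dominated (bound := domF B ℓ (e / 2)) ?_ ?_ (domF_int _ _ _) ?_
  · exact Eventually.of_forall fun x => Measurable.aestronglyMeasurable (by fun_prop)
  · filter_upwards [hev] with e' he'
    filter_upwards [self_mem_ae_restrict measurableSet_Ioi] with r hr
    rw [Real.norm_eq_abs, abs_of_nonneg (Real.sqrt_nonneg _)]
    exact le_domF h hl he' (by linarith) hr
  · refine Eventually.of_forall fun r => Continuous.continuousAt ?_
    fun_prop

lemma aPot_zero (h : GoodPot φ B c R) {ℓ : ℝ} (hl : 0 < ℓ) : ∃ e < 0, aPot φ e ℓ = 0 := by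
  refine ⟨-B ^ 2 / (2 * ℓ) - 1, ?_, ?_⟩
  · have : 0 ≤ B ^ 2 / (2 * ℓ) := by positivity
    rw [neg_div]; linarith
  · unfold aPot
    have : ∫ r in Ioi (0:ℝ), √(max (-B ^ 2 / (2 * ℓ) - 1 - psiPot φ ℓ r) 0) = 0 := by
      refine setIntegral_eq_zero_of_forall_eq_zero fun r hr => ?_
      have := psi_low h hl (mem_Ioi.1 hr)
      rw [max_eq_right (by linarith), Real.sqrt_zero]
    rw [this, mul_zero]

lemma aPot_top (h : GoodPot φ B c R) {ℓ : ℝ} (hl : 0 < ℓ) (m : ℝ) : ∃ e < 0, m ≤ aPot φ e ℓ := by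
  have hc := h.hc
  obtain ⟨n, hn⟩ : ∃ n : ℝ, 0 < n ∧ R ≤ n ∧ ℓ / c ≤ n ∧ 8 * m ^ 2 / c ≤ n := by
    refine ⟨max R (max (ℓ / c) (8 * m ^ 2 / c)), ?_, ?_, ?_, ?_⟩
    · exact h.hR.trans_le (le_max_left _ _)
    · exact le_max_left _ _
    · exact (le_max_left _ _).trans (le_max_right _ _)
    · exact (le_max_right _ _).trans (le_max_right _ _)
  obtain ⟨hn0, hnR, hnl, hnm⟩ := hn
  have he : -(c / (8 * n)) < 0 := by
    have : 0 < c / (8 * n) := by positivity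
    linarith
  refine ⟨-(c / (8 * n)), he, ?_⟩
  have hlow : n * √(c / (8 * n)) ≤
      ∫ r in Ioi (0:ℝ), √(max (-(c / (8 * n)) - psiPot φ ℓ r) 0) := by
    have h1 : ∫ r in Ioc n (2 * n), √(c / (8 * n)) = n * √(c / (8 * n)) := by
      rw [setIntegral_const]
      simp only [Measure.real, Real.volume_Ioc, smul_eq_mul]
      rw [ENNReal.toReal_ofReal (by linarith)]; ring
    rw [← h1]
    have hi := aInt_int h hl he
    have hsub : Ioc n (2 * n) ⊆ Ioi 0 := fun r hr => hn0.trans hr.1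
    refine le_trans ?_ (setIntegral_mono_set hi
      (Eventually.of_forall fun r => Real.sqrt_nonneg _) hsub.eventuallyLE)
    refine setIntegral_mono_on (integrableOn_const (by simp)) (hi.mono_measure
      (Measure.restrict_mono hsub le_rfl)) measurableSet_Ioc fun r hr => ?_
    apply Real.sqrt_le_sqrt
    refine le_trans ?_ (le_max_left _ _)
    have hr0 : 0 < r := hn0.trans hr.1
    have h2 := h.up r (hnR.trans hr.1.le)
    have h3 : ℓ / (2 * r ^ 2) ≤ c / (2 * r) := by
      rw [div_le_div_iff₀ (by positivity) (by positivity)]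
      have : ℓ ≤ c * r := by
        rw [div_le_iff₀ hc] at hnl
        nlinarith [hr.1]
      nlinarith
    have h4 : c / (4 * n) ≤ c / (2 * r) := by
      apply div_le_div_of_nonneg_left hc.le (by positivity)
      linarith [hr.2]
    have h5 : -c / r = -(c / (2 * r)) - c / (2 * r) := by field_simp; ring
    have h6 : c / (4 * n) = c / (8 * n) + c / (8 * n) := by field_simp; ring
    unfold psiPot
    linarith
  have h7 : m ≤ n * √(c / (8 * n)) := by
    refine (le_abs_self m).trans ?_
    rw [← Real.sqrt_sq_eq_abs]
    have : n * √(c / (8 * n)) = √(n * c / 8) := by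
      rw [← Real.sqrt_sq hn0.le, ← Real.sqrt_mul (by positivity), Real.sqrt_sq hn0.le]
      congr 1; field_simp
    rw [this]
    apply Real.sqrt_le_sqrt
    rw [div_le_iff₀ hc] at hnm
    linarith
  unfold aPot
  have hk : (1:ℝ) ≤ 8 * π ^ 2 * √2 := by
    have h1 : (1:ℝ) ≤ √2 := Real.one_le_sqrt.2 (by norm_num)
    have h2 := Real.pi_gt_three
    have h3 : (1:ℝ) ≤ 8 * π ^ 2 := by nlinarith
    nlinarith
  have hnn : 0 ≤ n * √(c / (8 * n)) := by positivity
  calc m ≤ n * √(c / (8 * n)) := h7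
    _ ≤ 1 * _ := by rw [one_mul]; exact hlow
    _ ≤ _ := mul_le_mul_of_nonneg_right hk (hnn.trans hlow)

lemma aPot_vol (h : GoodPot φ B c R) {ℓ : ℝ} (hl : 0 < ℓ) {e : ℝ} (he : e < 0) :
    ENNReal.ofReal (4 * π ^ 2) *
      volume {p : ℝ × ℝ | 0 < p.1 ∧ p.2 ^ 2 / 2 + psiPot φ ℓ p.1 < e} =
      ENNReal.ofReal (aPot φ e ℓ) := by
  have hpm := psi_meas h ℓ
  have hT : MeasurableSet {p : ℝ × ℝ | 0 < p.1 ∧ p.2 ^ 2 / 2 + psiPot φ ℓ p.1 < e} := by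
    have h1 : MeasurableSet {p : ℝ × ℝ | 0 < p.1} := measurableSet_lt (by fun_prop) (by fun_prop)
    have h2 : MeasurableSet {p : ℝ × ℝ | p.2 ^ 2 / 2 + psiPot φ ℓ p.1 < e} :=
      measurableSet_lt (by fun_prop) (by fun_prop)
    exact h1.inter h2
  rw [Measure.volume_eq_prod, Measure.prod_apply hT]
  have h1 : ∀ r : ℝ, volume (Prod.mk r ⁻¹' {p : ℝ × ℝ | 0 < p.1 ∧ p.2 ^ 2 / 2 + psiPot φ ℓ p.1 < e}) =
      (Ioi (0:ℝ)).indicator (fun r => ENNReal.ofReal (2 * √2 * √(max (e - psiPot φ ℓ r) 0))) r := by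
    intro r
    by_cases hr : 0 < r
    · rw [indicator_of_mem (mem_Ioi.2 hr)]
      have : Prod.mk r ⁻¹' {p : ℝ × ℝ | 0 < p.1 ∧ p.2 ^ 2 / 2 + psiPot φ ℓ p.1 < e} =
          Ioo (-(√2 * √(max (e - psiPot φ ℓ r) 0))) (√2 * √(max (e - psiPot φ ℓ r) 0)) := by
        ext a
        rw [← Real.sqrt_mul (by norm_num)]
        simp only [mem_preimage, mem_ofPred_eq, hr, true_and, mem_Ioo]
        rw [← abs_lt, Real.lt_sqrt (abs_nonneg _), sq_abs]
        constructor
        · intro ha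
          have := le_max_left (e - psiPot φ ℓ r) 0
          linarith
        · intro ha
          rcases le_total (e - psiPot φ ℓ r) 0 with h0 | h0
          · rw [max_eq_right h0] at ha; nlinarith [sq_nonneg a]
          · rw [max_eq_left h0] at ha; linarith
      rw [this, Real.volume_Ioo]
      congr 1; ring
    · rw [indicator_of_notMem (by simpa using hr)]
      simp [hr]
  simp_rw [h1]
  rw [lintegral_indicator measurableSet_Ioi, ← ofReal_integral_eq_lintegral_ofReal
    ((aInt_int h hl he).const_mul _) (Eventually.of_forall fun r => by positivity),
    integral_const_mul, ← ENNReal.ofReal_mul (by positivity)]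
  unfold aPot
  congr 1; ring

lemma aPot_ivt (h : GoodPot φ B c R) {ℓ : ℝ} (hl : 0 < ℓ) {m : ℝ} (hm : 0 ≤ m) :
    ∃ e < 0, aPot φ e ℓ = m := by
  obtain ⟨e0, he0, h0⟩ := aPot_zero h hl
  obtain ⟨e1, he1, h1⟩ := aPot_top h hl m
  have hsub : uIcc e0 e1 ⊆ Iio 0 := by
    intro x hx
    exact lt_of_le_of_lt hx.2 (max_lt he0 he1)
  have := intermediate_value_uIcc ((aPot_cont h hl).mono hsub)
  have hmem : m ∈ uIcc (aPot φ e0 ℓ) (aPot φ e1 ℓ) := by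
    rw [h0]; exact mem_uIcc_of_le hm h1
  obtain ⟨e, he, hh⟩ := this hmem
  exact ⟨e, hsub he, hh⟩

lemma aPot_dist (h : GoodPot φ B c R) {ℓ : ℝ} (hl : 0 < ℓ) (m : ℝ≥0∞) :
    ENNReal.ofReal (4 * π ^ 2) *
      volume {p : ℝ × ℝ | 0 < p.1 ∧ p.2 ^ 2 / 2 + psiPot φ ℓ p.1 < 0 ∧
        ENNReal.ofReal (aPot φ (p.2 ^ 2 / 2 + psiPot φ ℓ p.1) ℓ) < m} = m := by
  apply le_antisymm
  · by_cases hm : m = ⊤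
    · rw [hm]; exact le_top
    · obtain ⟨e, he, hh⟩ := aPot_ivt h hl (m := m.toReal) ENNReal.toReal_nonneg
      calc _ ≤ ENNReal.ofReal (4 * π ^ 2) *
            volume {p : ℝ × ℝ | 0 < p.1 ∧ p.2 ^ 2 / 2 + psiPot φ ℓ p.1 < e} := by
            refine mul_le_mul_right (measure_mono ?_) _
            intro p hp
            obtain ⟨h1, h2, h3⟩ := hp
            refine ⟨h1, ?_⟩
            by_contra hlt
            push Not at hlt
            have := aPot_mono h hl hlt h2
            rw [hh] at this
            have h4 := ENNReal.ofReal_le_ofReal this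
            rw [ENNReal.ofReal_toReal hm] at h4
            exact absurd h3 (not_lt.2 h4)
        _ = m := by rw [aPot_vol h hl he, hh, ENNReal.ofReal_toReal hm]
  · refine le_of_forall_lt fun m' hm' => ?_
    obtain ⟨m'', h1, h2⟩ := exists_between hm'
    have hne : m'' ≠ ⊤ := h2.ne_top
    obtain ⟨e, he, hh⟩ := aPot_ivt h hl (m := m''.toReal) ENNReal.toReal_nonneg
    calc m' < m'' := h1
      _ = ENNReal.ofReal (4 * π ^ 2) *
            volume {p : ℝ × ℝ | 0 < p.1 ∧ p.2 ^ 2 / 2 + psiPot φ ℓ p.1 < e} := by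
            rw [aPot_vol h hl he, hh, ENNReal.ofReal_toReal hne]
      _ ≤ _ := by
            refine mul_le_mul_right (measure_mono ?_) _
            intro p hp
            obtain ⟨h3, h4⟩ := hp
            refine ⟨h3, h4.trans he, ?_⟩
            have := aPot_mono h hl h4.le he
            rw [hh] at this
            have h5 := ENNReal.ofReal_le_ofReal this
            rw [ENNReal.ofReal_toReal hne] at h5
            exact h5.trans_lt h2

end PotSec

structure Dens (ρ : E3 → ℝ) : Prop where
  meas : Measurable ρ
  nonneg : ∀ x, 0 ≤ ρ x
  inv : ∀ R : E3 ≃ₗᵢ[ℝ] E3, IsRot R → ∀ x, ρ (R x) = ρ x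
  int : Integrable ρ

def potD (ρ : E3 → ℝ) (x : E3) : ℝ := - ∫ y : E3, ρ y / (4 * π * ‖x - y‖)

def mD (ρ : E3 → ℝ) (s : ℝ) : ℝ := ∫ y in Metric.ball (0:E3) s, ρ y

def PD (ρ : E3 → ℝ) (r : ℝ) : ℝ := ∫ y, ρ y / max r ‖y‖

lemma Dens.rad {ρ : E3 → ℝ} (h : Dens ρ) (x : E3) : ρ x = ρ (‖x‖ • bv 0) := by
  obtain ⟨R, hR, h1⟩ := exists_rot_norm x
  rw [← h1, h.inv R hR]

lemma int_inv_sqrt (r s : ℝ) (hr : 0 < r) (hs : 0 < s) :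
    ∫⁻ a in Ioo (-s) s, ENNReal.ofReal (1 / √(r ^ 2 + s ^ 2 - 2 * r * a)) =
      ENNReal.ofReal (2 * s / max r s) := by
  have hle : -s ≤ s := by linarith
  have hc : ContinuousOn (fun a => -√(r ^ 2 + s ^ 2 - 2 * r * a) / r) (Icc (-s) s) := by
    fun_prop
  have hd : ∀ a ∈ Ioo (-s) s, HasDerivAt (fun a => -√(r ^ 2 + s ^ 2 - 2 * r * a) / r)
      (1 / √(r ^ 2 + s ^ 2 - 2 * r * a)) a := by
    intro a ha
    have hpos : 0 < r ^ 2 + s ^ 2 - 2 * r * a := by nlinarith [ha.2, sq_nonneg (r - s)]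
    have h1 : HasDerivAt (fun a => r ^ 2 + s ^ 2 - 2 * r * a) (-(2 * r)) a := by
      simpa using ((hasDerivAt_id a).const_mul (2 * r)).const_sub (r ^ 2 + s ^ 2)
    have h2 := ((h1.sqrt hpos.ne').neg).div_const r
    refine h2.congr_deriv ?_
    have := Real.sqrt_pos.2 hpos
    field_simp
  have hi := intervalIntegral.integrableOn_deriv_of_nonneg hc hd (fun a _ => by positivity)
  have hI := intervalIntegral.integral_eq_sub_of_hasDerivAt_of_le hle hc hd
    ((intervalIntegrable_iff_integrableOn_Ioc_of_le hle).2 hi)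
  rw [← setLIntegral_congr Ioo_ae_eq_Ioc.symm, ← ofReal_integral_eq_lintegral_ofReal hi
    (Eventually.of_forall fun a => by positivity), ← intervalIntegral.integral_of_le hle, hI]
  congr 1
  have e1 : r ^ 2 + s ^ 2 - 2 * r * s = (r - s) ^ 2 := by ring
  have e2 : r ^ 2 + s ^ 2 - 2 * r * -s = (r + s) ^ 2 := by ring
  rw [e1, e2, Real.sqrt_sq_eq_abs, Real.sqrt_sq (by positivity)]
  rcases le_total r s with h | h
  · rw [max_eq_right h, abs_of_nonpos (by linarith)]; field_simp; ring
  · rw [max_eq_left h, abs_of_nonneg (by linarith)]; field_simp; ring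

lemma newton_lint {ρ : E3 → ℝ} (h : Dens ρ) (r : ℝ) (hr : 0 < r) :
    ∫⁻ y, ENNReal.ofReal (ρ y / ‖r • bv 0 - y‖) = ∫⁻ y, ENNReal.ofReal (ρ y / max r ‖y‖) := by
  have hm := h.meas
  have hw : Measurable fun s : ℝ => ρ (s • bv 0) := hm.comp (by fun_prop)
  have e1 : ∀ y : E3, ENNReal.ofReal (ρ y / ‖r • bv 0 - y‖) =
      (fun a t => ENNReal.ofReal (ρ ((√t) • bv 0) * (1 / √(r ^ 2 + t - 2 * r * a)))) (y 0) (‖y‖ ^ 2) := by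
    intro y
    simp only
    rw [Real.sqrt_sq (norm_nonneg _), ← h.rad, div_eq_mul_one_div]
    congr 4
    rw [← Real.sqrt_sq (norm_nonneg (r • bv 0 - y))]
    congr 1
    rw [normsq_three, normsq_three y]
    simp [bv]
    ring
  have e2 : ∀ y : E3, ENNReal.ofReal (ρ y / max r ‖y‖) =
      (fun s => ENNReal.ofReal (ρ (s • bv 0) / max r s)) ‖y‖ := by
    intro y; simp only; rw [← h.rad]
  rw [lintegral_congr e1, lintegral_congr e2,
    lint_shell (fun a t => ENNReal.ofReal (ρ ((√t) • bv 0) * (1 / √(r ^ 2 + t - 2 * r * a)))),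
    lint_rad (fun s => ENNReal.ofReal (ρ (s • bv 0) / max r s))]
  · rw [ENNReal.ofReal_mul (by norm_num), mul_comm (ENNReal.ofReal 4), mul_assoc,
      ← lintegral_const_mul' (ENNReal.ofReal 4) _ (by simp)]
    congr 1
    refine setLIntegral_congr_fun measurableSet_Ioi fun s hs => ?_
    have hs : 0 < s := hs
    rw [Real.sqrt_sq hs.le]
    have : ∀ a, ENNReal.ofReal (ρ (s • bv 0) * (1 / √(r ^ 2 + s ^ 2 - 2 * r * a))) =
      ENNReal.ofReal (ρ (s • bv 0)) * ENNReal.ofReal (1 / √(r ^ 2 + s ^ 2 - 2 * r * a)) := fun a =>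
        ENNReal.ofReal_mul (h.nonneg _)
    simp_rw [this]
    rw [lintegral_const_mul' _ _ (by simp), int_inv_sqrt r s hr hs, ← ENNReal.ofReal_mul (h.nonneg _),
      ← ENNReal.ofReal_mul (by positivity), ← ENNReal.ofReal_mul (by positivity),
      ← ENNReal.ofReal_mul (by positivity)]
    congr 1
    have : 0 < max r s := lt_max_of_lt_left hr
    field_simp; ring
  · exact (hw.div (by fun_prop)).ennreal_ofReal
  · refine Measurable.ennreal_ofReal ?_
    have : Measurable fun q : ℝ × ℝ => ρ ((√q.2) • bv 0) := hw.comp (g := fun s : ℝ => ρ (s • bv 0)) (by fun_prop : Measurable fun q : ℝ × ℝ => √q.2)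
    exact this.mul (by fun_prop)

lemma potD_eq {ρ : E3 → ℝ} (h : Dens ρ) (r : ℝ) (hr : 0 < r) :
    potD ρ (r • bv 0) = -(PD ρ r / (4 * π)) := by
  unfold potD PD
  have hm := h.meas
  rw [neg_inj, ← integral_div, integral_eq_lintegral_of_nonneg_ae, integral_eq_lintegral_of_nonneg_ae]
  · congr 1
    have := newton_lint h r hr
    have e1 : ∀ y, ENNReal.ofReal (ρ y / (4 * π * ‖r • bv 0 - y‖)) = ENNReal.ofReal (1 / (4 * π)) * ENNReal.ofReal (ρ y / ‖r • bv 0 - y‖) := by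
      intro y
      rw [← ENNReal.ofReal_mul (by positivity)]; congr 1
      rw [div_mul_div_comm, one_mul]
    have e2 : ∀ y, ENNReal.ofReal (ρ y / max r ‖y‖ / (4 * π)) = ENNReal.ofReal (1 / (4 * π)) * ENNReal.ofReal (ρ y / max r ‖y‖) := by
      intro y
      rw [← ENNReal.ofReal_mul (by positivity)]; congr 1
      ring
    simp_rw [e1, e2]
    rw [lintegral_const_mul' _ _ (by simp), lintegral_const_mul' _ _ (by simp), this]
  · exact Eventually.of_forall fun y => div_nonneg (div_nonneg (h.nonneg _) (by positivity)) (by positivity)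
  · exact Measurable.aestronglyMeasurable (by fun_prop)
  · exact Eventually.of_forall fun y => div_nonneg (h.nonneg _) (by positivity)
  · exact Measurable.aestronglyMeasurable (by fun_prop)

lemma PD_int {ρ : E3 → ℝ} (h : Dens ρ) (r : ℝ) (hr : 0 < r) : Integrable fun y => ρ y / max r ‖y‖ := by
  have hm := h.meas
  refine (h.int.div_const r).mono' (Measurable.aestronglyMeasurable (by fun_prop)) (Eventually.of_forall fun y => ?_)
  rw [Real.norm_of_nonneg (div_nonneg (h.nonneg _) (by positivity))]
  exact div_le_div_of_nonneg_left (h.nonneg _) hr (le_max_left _ _)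

lemma PD_nonneg {ρ : E3 → ℝ} (h : Dens ρ) (r : ℝ) : 0 ≤ PD ρ r :=
  integral_nonneg fun y => div_nonneg (h.nonneg _) (le_max_of_le_right (norm_nonneg _))

lemma PD_le {ρ : E3 → ℝ} (h : Dens ρ) (r : ℝ) (hr : 0 < r) : PD ρ r ≤ (∫ y, ρ y) / r := by
  unfold PD
  rw [← integral_div]
  refine integral_mono (PD_int h r hr) (h.int.div_const r) fun y => ?_
  exact div_le_div_of_nonneg_left (h.nonneg _) hr (le_max_left _ _)

lemma PD_ge {ρ : E3 → ℝ} (h : Dens ρ) (r R : ℝ) (hR : 0 < R) (hr : R ≤ r) : mD ρ R / r ≤ PD ρ r := by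
  have hr0 := hR.trans_le hr
  unfold PD mD
  rw [← integral_div]
  calc _ = ∫ y in Metric.ball (0:E3) R, ρ y / max r ‖y‖ := by
        refine setIntegral_congr_fun measurableSet_ball fun y hy => ?_
        have : ‖y‖ < R := by simpa using hy
        rw [max_eq_left (by linarith)]
    _ ≤ _ := setIntegral_le_integral (PD_int h r hr0) (Eventually.of_forall fun y => div_nonneg (h.nonneg _) (by positivity))

lemma PD_deriv {ρ : E3 → ℝ} (h : Dens ρ) (r : ℝ) (hr : 0 < r) :
    HasDerivAt (PD ρ) (-(mD ρ r / r ^ 2)) r := by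
  have hm := h.meas
  have key := hasDerivAt_integral_of_dominated_loc_of_lip (μ := (volume : Measure E3))
    (F := fun r y => ρ y / max r ‖y‖) (F' := fun y => (Metric.ball (0:E3) r).indicator (fun y => -(ρ y / r ^ 2)) y)
    (x₀ := r) (s := Metric.ball r (r / 2)) (bound := fun y => ρ y * (4 / r ^ 2)) (Metric.ball_mem_nhds _ (by positivity))
    (Eventually.of_forall fun r' => Measurable.aestronglyMeasurable (by fun_prop))
    (PD_int h r hr)
    (Measurable.aestronglyMeasurable (Measurable.indicator (by fun_prop) measurableSet_ball))
    (Eventually.of_forall fun y => by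
      refine LipschitzOnWith.of_dist_le_mul fun a ha b hb => ?_
      rw [Real.ball_eq_Ioo] at ha hb
      have ha1 := ha.1
      have hb1 := hb.1
      have hA : r / 2 ≤ max a ‖y‖ := le_max_of_le_left (by linarith)
      have hB : r / 2 ≤ max b ‖y‖ := le_max_of_le_left (by linarith)
      have hA0 : 0 < max a ‖y‖ := by linarith
      have hB0 : 0 < max b ‖y‖ := by linarith
      rw [Real.dist_eq, Real.dist_eq, Real.coe_nnabs, abs_of_nonneg (mul_nonneg (h.nonneg y) (by positivity))]
      have : ρ y / max a ‖y‖ - ρ y / max b ‖y‖ = ρ y * ((max b ‖y‖ - max a ‖y‖) / (max a ‖y‖ * max b ‖y‖)) := by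
        field_simp
      rw [this, abs_mul, abs_of_nonneg (h.nonneg y), mul_assoc]
      refine mul_le_mul_of_nonneg_left ?_ (h.nonneg y)
      rw [abs_div, abs_of_pos (mul_pos hA0 hB0), div_le_iff₀ (mul_pos hA0 hB0)]
      have h1 : |max b ‖y‖ - max a ‖y‖| ≤ |a - b| := by
        rw [abs_sub_comm a b]
        exact abs_max_sub_max_le_abs _ _ _
      have h2 : r / 2 * (r / 2) ≤ max a ‖y‖ * max b ‖y‖ := mul_le_mul hA hB (by positivity) hA0.le
      calc _ ≤ |a - b| := h1
        _ = 4 / r ^ 2 * |a - b| * (r / 2 * (r / 2)) := by field_simp; norm_num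
        _ ≤ _ := mul_le_mul_of_nonneg_left h2 (by positivity))
    (h.int.mul_const _)
    (by
      have : ∀ᵐ y : E3, y ∉ Metric.sphere (0:E3) r := by
        exact compl_mem_ae_iff.2 (Measure.addHaar_sphere volume _ _)
      filter_upwards [this] with y hy
      have hy : ‖y‖ ≠ r := by simpa using hy
      rcases lt_or_gt_of_ne hy with h1 | h1
      · rw [indicator_of_mem (by simpa using h1)]
        have : HasDerivAt (fun r => ρ y / r) (-(ρ y / r ^ 2)) r := by
          have := (hasDerivAt_inv hr.ne').const_mul (ρ y)
          simpa [div_eq_mul_inv] using this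
        refine this.congr_of_eventuallyEq ?_
        filter_upwards [lt_mem_nhds h1] with a ha
        rw [max_eq_left ha.le]
      · rw [indicator_of_notMem (by simpa using h1.le)]
        refine (hasDerivAt_const r (ρ y / ‖y‖)).congr_of_eventuallyEq ?_
        filter_upwards [gt_mem_nhds h1] with a ha
        rw [max_eq_right ha.le])
  have h2 := key.2
  rw [integral_indicator measurableSet_ball, integral_neg, integral_div] at h2
  exact h2

lemma memErad.meas {g : Phase → ℝ} (h : memErad g) : Measurable g := h.1.1
lemma memErad.nonneg {g : Phase → ℝ} (h : memErad g) (z : Phase) : 0 ≤ g z := h.1.2.1 z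
lemma memErad.l1 {g : Phase → ℝ} (h : memErad g) : eLpNorm g 1 volume < ⊤ := by
  refine lt_of_le_of_lt ?_ h.1.2.2
  unfold eNormE
  rw [add_assoc]; exact le_self_add
lemma memErad.linf {g : Phase → ℝ} (h : memErad g) : eLpNorm g ⊤ volume < ⊤ := by
  refine lt_of_le_of_lt ?_ h.1.2.2
  unfold eNormE
  rw [add_assoc]; exact le_self_add.trans le_add_self
lemma memErad.kin {g : Phase → ℝ} (h : memErad g) :
    ∫⁻ z : Phase, (‖z.2‖₊ : ℝ≥0∞) ^ 2 * (‖g z‖₊ : ℝ≥0∞) < ⊤ := by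
  refine lt_of_le_of_lt ?_ h.1.2.2
  unfold eNormE
  exact le_add_self
lemma memErad.int {g : Phase → ℝ} (h : memErad g) : Integrable g :=
  memLp_one_iff_integrable.1 ⟨h.meas.aestronglyMeasurable, h.l1⟩

lemma rot_int (R : E3 ≃ₗᵢ[ℝ] E3) (F : E3 → ℝ) : ∫ v, F (R v) = ∫ v, F v :=
  (R.measurePreserving).integral_comp R.toHomeomorph.measurableEmbedding F

lemma rho_dens {g : Phase → ℝ} (h : memErad g) : Dens (rhoF g) where
  meas := h.meas.stronglyMeasurable.integral_prod_right'.measurable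
  nonneg x := integral_nonneg fun v => h.nonneg _
  inv R hR x := by
    unfold rhoF
    rw [← rot_int R]
    refine integral_congr_ae (Eventually.of_forall fun v => ?_)
    exact h.2 R hR (x, v)
  int := by
    have := h.int
    rw [Measure.volume_eq_prod] at this
    exact this.integral_prod_left

lemma phiF_eq (g : Phase → ℝ) : phiF g = potD (rhoF g) := rfl

lemma potD_inv {ρ : E3 → ℝ} (h : Dens ρ) (R : E3 ≃ₗᵢ[ℝ] E3) (hR : IsRot R) (x : E3) :
    potD ρ (R x) = potD ρ x := by
  unfold potD
  rw [← rot_int R, neg_inj]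
  refine integral_congr_ae (Eventually.of_forall fun v => ?_)
  simp only
  rw [h.inv R hR, ← map_sub, LinearIsometryEquiv.norm_map]

lemma phiF_rad {g : Phase → ℝ} (h : memErad g) (x : E3) : phiF g x = phiRad g ‖x‖ := by
  obtain ⟨R, hR, h1⟩ := exists_rot_norm x
  unfold phiRad
  rw [phiF_eq, ← potD_inv (rho_dens h) R hR, h1, bv]

lemma phiF_meas {g : Phase → ℝ} (h : memErad g) : Measurable (phiF g) := by
  have hm := (rho_dens h).meas
  have : Measurable fun q : E3 × E3 => rhoF g q.2 / (4 * π * ‖q.1 - q.2‖) := by fun_prop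
  exact this.stronglyMeasurable.integral_prod_right'.measurable.neg

lemma phiRad_meas {g : Phase → ℝ} (h : memErad g) : Measurable (phiRad g) :=
  (phiF_meas h).comp (g := phiF g) (by fun_prop : Measurable fun r : ℝ => r • bv 0)

lemma phiRad_eq {g : Phase → ℝ} (h : memErad g) (r : ℝ) (hr : 0 < r) :
    phiRad g r = -(PD (rhoF g) r / (4 * π)) := potD_eq (rho_dens h) r hr

lemma mD_nonneg {ρ : E3 → ℝ} (h : Dens ρ) (r : ℝ) : 0 ≤ mD ρ r :=
  integral_nonneg fun _ => h.nonneg _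

lemma mD_mono {ρ : E3 → ℝ} (h : Dens ρ) : Monotone (mD ρ) := fun _ _ hab =>
  setIntegral_mono_set h.int.integrableOn (Eventually.of_forall fun _ => h.nonneg _)
    (Metric.ball_subset_ball hab).eventuallyLE

lemma mD_le {ρ : E3 → ℝ} (h : Dens ρ) (r : ℝ) : mD ρ r ≤ ∫ y, ρ y :=
  setIntegral_le_integral h.int (Eventually.of_forall fun _ => h.nonneg _)

lemma exists_mD {ρ : E3 → ℝ} (h : Dens ρ) (hne : potD ρ ≠ 0) : ∃ R, 0 < R ∧ 0 < mD ρ R := by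
  by_contra! hcon
  apply hne
  have h0 : ρ =ᵐ[volume] 0 := by
    have h1 : ∀ n : ℕ, ∀ᵐ y ∂(volume.restrict (Metric.ball (0:E3) n)), ρ y = 0 := by
      intro n
      have : mD ρ (n + 1) = 0 := le_antisymm (hcon _ (by positivity)) (mD_nonneg h _)
      unfold mD at this
      rw [setIntegral_eq_zero_iff_of_nonneg_ae (Eventually.of_forall fun _ => h.nonneg _) h.int.integrableOn] at this
      exact ae_restrict_of_ae_restrict_of_subset (Metric.ball_subset_ball (by linarith)) this
    have h2 := ae_restrict_iUnion_iff (fun n : ℕ => Metric.ball (0:E3) n) (fun y => ρ y = 0) |>.2 h1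
    rwa [Metric.iUnion_ball_nat, Measure.restrict_univ] at h2
  funext x
  unfold potD
  rw [integral_eq_zero_of_ae, neg_zero]; rfl
  filter_upwards [h0] with y hy
  simp [hy]

lemma good_pot {g : Phase → ℝ} (h : memErad g) (hne : phiF g ≠ 0) :
    ∃ B c R, GoodPot (phiRad g) B c R := by
  obtain ⟨R, hR, hm⟩ := exists_mD (rho_dens h) hne
  have hd := rho_dens h
  refine ⟨(∫ y, rhoF g y) / (4 * π), mD (rhoF g) R / (4 * π), R, phiRad_meas h, ?_, by positivity, hR, ?_, ?_⟩
  · exact div_nonneg (integral_nonneg fun _ => hd.nonneg _) (by positivity)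
  · intro r hr
    rw [phiRad_eq h r hr, neg_div, neg_le_neg_iff, div_right_comm]
    exact div_le_div_of_nonneg_right (PD_le hd r hr) (by positivity)
  · intro r hr
    rw [phiRad_eq h r (hR.trans_le hr), neg_div, neg_le_neg_iff, div_right_comm]
    exact div_le_div_of_nonneg_right (PD_ge hd r R hR hr) (by positivity)

lemma grad_norm {g : Phase → ℝ} (h : memErad g) (x : E3) (hx : x ≠ 0) :
    ‖gradPhi g x‖ = mD (rhoF g) ‖x‖ / (4 * π * ‖x‖ ^ 2) := by
  have hd := rho_dens h
  have hx' : 0 < ‖x‖ := norm_pos_iff.2 hx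
  have h1 : HasFDerivAt (fun y : E3 => √(‖y‖ ^ 2)) ((1 / (2 * √(‖x‖ ^ 2))) • ((2:ℝ) • innerSL ℝ x)) x := by
    have := ((hasStrictFDerivAt_norm_sq x).hasFDerivAt).sqrt (by positivity)
    rw [← Nat.cast_smul_eq_nsmul ℝ] at this
    exact this
  have h2 : HasFDerivAt (fun y : E3 => ‖y‖) ((1 / (2 * √(‖x‖ ^ 2))) • ((2:ℝ) • innerSL ℝ x)) x := by
    refine h1.congr_of_eventuallyEq (Eventually.of_forall fun y => ?_)
    simp only
    rw [Real.sqrt_sq (norm_nonneg _)]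
  have h3 := (((PD_deriv hd ‖x‖ hx').div_const (4 * π)).neg).comp_hasFDerivAt x h2
  have h4 : HasFDerivAt (phiF g) _ x := h3.congr_of_eventuallyEq (by
    filter_upwards [isOpen_ne.mem_nhds hx] with y hy
    rw [phiF_rad h, phiRad_eq h _ (norm_pos_iff.2 hy)]
    rfl)
  unfold gradPhi gradient
  rw [LinearIsometryEquiv.norm_map, h4.fderiv, Real.sqrt_sq hx'.le, norm_smul, norm_smul, norm_smul, innerSL_apply_norm]
  have hm := mD_nonneg hd ‖x‖
  rw [neg_div, neg_neg, Real.norm_of_nonneg (by positivity), Real.norm_of_nonneg (by positivity), Real.norm_of_nonneg (by positivity)]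
  field_simp

lemma mD_small {g : Phase → ℝ} (h : memErad g) :
    ∃ C, 0 ≤ C ∧ ∀ s, 0 < s → s ≤ 1 → mD (rhoF g) s ≤ C * s := by
  have hd := rho_dens h
  set N := (eLpNorm g ⊤ volume)
  set K := ∫⁻ z : Phase, (‖z.2‖₊ : ℝ≥0∞) ^ 2 * (‖g z‖₊ : ℝ≥0∞) with hK
  set b := volume (Metric.ball (0:E3) 1) with hb
  have hN : N ≠ ⊤ := h.linf.ne
  have hKt : K ≠ ⊤ := h.kin.ne
  have hbt : b ≠ ⊤ := measure_ball_lt_top.ne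
  have hgN : ∀ᵐ z : Phase, (‖g z‖ₑ) ≤ N := by
    have := ae_le_eLpNormEssSup (f := g) (μ := volume)
    simpa [N, eLpNorm_exponent_top] using this
  refine ⟨(N * b * b + K).toReal, ENNReal.toReal_nonneg, fun s hs hs1 => ?_⟩
  have hle : ENNReal.ofReal (mD (rhoF g) s) ≤ (N * b * b + K) * ENNReal.ofReal s := by
    have h1 : ENNReal.ofReal (mD (rhoF g) s) ≤ ∫⁻ z : Phase, (Metric.ball (0:E3) s ×ˢ univ).indicator (fun z => ‖g z‖ₑ) z := by
      rw [lintegral_indicator (measurableSet_ball.prod MeasurableSet.univ), Measure.volume_eq_prod,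
        ← Measure.prod_restrict, lintegral_prod _ h.meas.enorm.aemeasurable, Measure.restrict_univ]
      unfold mD
      rw [ofReal_integral_eq_lintegral_ofReal hd.int.integrableOn (Eventually.of_forall fun _ => hd.nonneg _)]
      refine lintegral_mono fun x => ?_
      rw [← enorm_of_nonneg (hd.nonneg x)]
      exact enorm_integral_le_lintegral_enorm _
    refine h1.trans ?_
    have hS : MeasurableSet (Metric.ball (0:E3) s ×ˢ Metric.ball (0:E3) (√(1/s))) := measurableSet_ball.prod measurableSet_ball
    have h2 : ∀ᵐ z : Phase, (Metric.ball (0:E3) s ×ˢ univ).indicator (fun z => ‖g z‖ₑ) z ≤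
        (Metric.ball (0:E3) s ×ˢ Metric.ball (0:E3) (√(1/s))).indicator (fun _ => N) z
         + ENNReal.ofReal s * ((‖z.2‖₊ : ℝ≥0∞) ^ 2 * (‖g z‖₊ : ℝ≥0∞)) := by
      filter_upwards [hgN] with z hz
      by_cases hz1 : z.1 ∈ Metric.ball (0:E3) s
      · rw [indicator_of_mem (show z ∈ Metric.ball (0:E3) s ×ˢ univ from ⟨hz1, mem_univ _⟩)]
        by_cases hz2 : z.2 ∈ Metric.ball (0:E3) (√(1/s))
        · rw [indicator_of_mem (show z ∈ Metric.ball (0:E3) s ×ˢ Metric.ball (0:E3) (√(1/s)) from ⟨hz1, hz2⟩)]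
          exact hz.trans le_self_add
        · refine le_trans ?_ le_add_self
          rw [← mul_assoc]
          have : (1:ℝ≥0∞) ≤ ENNReal.ofReal s * (‖z.2‖₊ : ℝ≥0∞) ^ 2 := by
            rw [show (‖z.2‖₊ : ℝ≥0∞) = ENNReal.ofReal ‖z.2‖ from (ofReal_norm z.2).symm, ← ENNReal.ofReal_pow (norm_nonneg _), ← ENNReal.ofReal_mul hs.le, ← ENNReal.ofReal_one]
            refine ENNReal.ofReal_le_ofReal ?_
            have : √(1/s) ≤ ‖z.2‖ := by simpa using hz2
            have := Real.sqrt_le_left (norm_nonneg _) |>.1 this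
            rw [div_le_iff₀ hs] at this
            linarith
          calc _ = 1 * ‖g z‖ₑ := (one_mul _).symm
            _ ≤ _ := mul_le_mul_left this _
      · rw [indicator_of_notMem (by simpa using hz1)]; exact zero_le
    refine (lintegral_mono_ae h2).trans ?_
    rw [lintegral_add_left (measurable_const.indicator hS), lintegral_indicator hS, setLIntegral_const, lintegral_const_mul' _ _ (by simp),
      ← hK, Measure.volume_eq_prod, Measure.prod_prod, Measure.addHaar_ball _ _ hs.le, Measure.addHaar_ball _ _ (Real.sqrt_nonneg (1/s)), ← hb, add_mul]
    refine add_le_add ?_ (by rw [mul_comm])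
    simp only [finrank_euclideanSpace, Fintype.card_fin]
    have : ENNReal.ofReal (s ^ 3) * ENNReal.ofReal (√(1/s) ^ 3) ≤ ENNReal.ofReal s := by
      rw [← ENNReal.ofReal_mul (by positivity)]
      refine ENNReal.ofReal_le_ofReal ?_
      have e : √(1/s) ^ 2 = 1 / s := Real.sq_sqrt (by positivity)
      have e2 : s * √(1/s) ≤ 1 := by
        rw [← Real.sqrt_sq hs.le, ← Real.sqrt_mul (by positivity), Real.sqrt_sq hs.le]
        rw [Real.sqrt_le_one]
        rw [mul_one_div, sq, mul_div_cancel_right₀ _ hs.ne']; exact hs1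
      calc s ^ 3 * √(1/s) ^ 3 = s ^ 2 * (√(1/s) ^ 2) * (s * √(1/s)) := by ring
        _ = s * (s * √(1/s)) := by rw [e]; field_simp
        _ ≤ s * 1 := mul_le_mul_of_nonneg_left e2 hs.le
        _ = s := mul_one s
    calc _ = N * b * b * (ENNReal.ofReal (s ^ 3) * ENNReal.ofReal (√(1/s) ^ 3)) := by ring
      _ ≤ _ := mul_le_mul_right this _
  have hC : N * b * b + K ≠ ⊤ := ENNReal.add_ne_top.2 ⟨ENNReal.mul_ne_top (ENNReal.mul_ne_top hN hbt) hbt, hKt⟩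
  rw [← ENNReal.ofReal_toReal hC, ← ENNReal.ofReal_mul ENNReal.toReal_nonneg] at hle
  exact (ENNReal.ofReal_le_ofReal_iff (by positivity)).1 hle

lemma inv_sq_Ioi (r : ℝ) (hr : 0 < r) :
    ∫⁻ s in Ioi r, ENNReal.ofReal (s ^ (-2:ℝ)) = ENNReal.ofReal (1 / r) := by
  rw [← ofReal_integral_eq_lintegral_ofReal (integrableOn_Ioi_rpow_of_lt (by norm_num) hr)]
  · rw [integral_Ioi_rpow_of_lt (by norm_num) hr]
    congr 1
    norm_num
    rw [Real.rpow_neg hr.le, Real.rpow_one]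
  · filter_upwards [self_mem_ae_restrict measurableSet_Ioi] with s hs
    exact Real.rpow_nonneg (hr.trans hs).le _

lemma fieldSq_ge {g : Phase → ℝ} (h : memErad g) (r : ℝ) (hr : 0 < r) :
    mD (rhoF g) r ^ 2 / (4 * π * r) ≤ fieldSq g := by
  have hd := rho_dens h
  set m := mD (rhoF g) with hm
  have hmm : Measurable m := (mD_mono hd).measurable
  have hm0 : ∀ s, 0 ≤ m s := mD_nonneg hd
  set H : ℝ → ℝ := fun s => (m s / (4 * π * s ^ 2)) ^ 2 with hH
  have hHm : Measurable H := by fun_prop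
  have hae : (fun x => ‖gradPhi g x‖ ^ 2) =ᵐ[volume] fun x : E3 => H ‖x‖ := by
    have : ∀ᵐ x : E3, x ≠ 0 := by
      exact compl_mem_ae_iff.2 (measure_singleton (0:E3))
    filter_upwards [this] with x hx
    rw [grad_norm h x hx]
  have hf : fieldSq g = (∫⁻ x : E3, ENNReal.ofReal (H ‖x‖)).toReal := by
    unfold fieldSq
    rw [integral_congr_ae hae, integral_eq_lintegral_of_nonneg_ae (Eventually.of_forall fun _ => sq_nonneg _)]
    exact (hHm.comp measurable_norm).aestronglyMeasurable
  have hrad := lint_rad (fun s => ENNReal.ofReal (H s)) hHm.ennreal_ofReal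
  have hpt : ∀ s, 0 < s → ENNReal.ofReal (s ^ 2) * ENNReal.ofReal (H s) = ENNReal.ofReal ((m s / (4 * π)) ^ 2 * s ^ (-2:ℝ)) := by
    intro s hs
    rw [← ENNReal.ofReal_mul (by positivity)]
    congr 1
    rw [Real.rpow_neg hs.le, Real.rpow_two]
    simp only [hH]
    field_simp
  have hfin : ∫⁻ x : E3, ENNReal.ofReal (H ‖x‖) ≠ ⊤ := by
    rw [hrad]
    refine ENNReal.mul_ne_top ENNReal.ofReal_ne_top ?_
    rw [← Ioc_union_Ioi_eq_Ioi zero_le_one, lintegral_union measurableSet_Ioi Set.Ioc_disjoint_Ioi_same]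
    refine ENNReal.add_ne_top.2 ⟨?_, ?_⟩
    · obtain ⟨C, hC, hs⟩ := mD_small h
      have : ∫⁻ s in Ioc (0:ℝ) 1, ENNReal.ofReal (s ^ 2) * ENNReal.ofReal (H s) ≤ ∫⁻ s in Ioc (0:ℝ) 1, ENNReal.ofReal ((C / (4 * π)) ^ 2) := by
        refine setLIntegral_mono measurable_const fun s hs' => ?_
        rw [hpt s hs'.1]
        refine ENNReal.ofReal_le_ofReal ?_
        have h1 := hs s hs'.1 hs'.2
        have hsp := hs'.1
        rw [Real.rpow_neg hs'.1.le, Real.rpow_two, ← div_eq_mul_inv, div_le_iff₀ (by positivity), ← mul_pow]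
        refine pow_le_pow_left₀ (div_nonneg (hm0 s) (by positivity)) ?_ 2
        rw [div_mul_eq_mul_div]
        exact div_le_div_of_nonneg_right h1 (by positivity)
      refine ne_top_of_le_ne_top ?_ this
      rw [setLIntegral_const]
      exact ENNReal.mul_ne_top (by simp) (by simp)
    · have : ∫⁻ s in Ioi (1:ℝ), ENNReal.ofReal (s ^ 2) * ENNReal.ofReal (H s) ≤ ∫⁻ s in Ioi (1:ℝ), ENNReal.ofReal (((∫ y, rhoF g y) / (4 * π)) ^ 2) * ENNReal.ofReal (s ^ (-2:ℝ)) := by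
        refine setLIntegral_mono (by fun_prop) fun s hs' => ?_
        have hsp : 0 < s := lt_trans one_pos hs'
        rw [hpt s hsp, ENNReal.ofReal_mul (by positivity)]
        refine mul_le_mul_left (ENNReal.ofReal_le_ofReal ?_) _
        exact pow_le_pow_left₀ (div_nonneg (hm0 s) (by positivity)) (div_le_div_of_nonneg_right (mD_le hd s) (by positivity)) 2
      refine ne_top_of_le_ne_top ?_ this
      rw [lintegral_const_mul' _ _ (by simp), inv_sq_Ioi 1 one_pos]
      exact ENNReal.mul_ne_top (by simp) (by simp)
  rw [hf, ← ENNReal.ofReal_le_iff_le_toReal hfin, hrad]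
  calc ENNReal.ofReal (m r ^ 2 / (4 * π * r)) = ENNReal.ofReal (4 * π) * (ENNReal.ofReal ((m r / (4 * π)) ^ 2) * ∫⁻ s in Ioi r, ENNReal.ofReal (s ^ (-2:ℝ))) := by
        rw [inv_sq_Ioi r hr, ← ENNReal.ofReal_mul (by positivity), ← ENNReal.ofReal_mul (by positivity)]
        congr 1
        field_simp
    _ ≤ _ := by
        refine mul_le_mul_right ?_ _
        rw [← lintegral_const_mul' _ _ (by simp)]
        refine le_trans ?_ (lintegral_mono_set (Ioi_subset_Ioi hr.le))
        refine setLIntegral_mono (by fun_prop) fun s hs => ?_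
        have hs : r < s := hs
        rw [hpt s (hr.trans hs), ENNReal.ofReal_mul (by positivity)]
        refine mul_le_mul_left (ENNReal.ofReal_le_ofReal ?_) _
        exact pow_le_pow_left₀ (div_nonneg (hm0 r) (by positivity)) (div_le_div_of_nonneg_right (mD_mono hd hs.le) (by positivity)) 2

lemma mD_bd {g : Phase → ℝ} (h : memErad g) (r : ℝ) (hr : 0 < r) :
    mD (rhoF g) r ≤ 4 * √(fieldSq g) * √r := by
  have h1 := fieldSq_ge h r hr
  have hm := mD_nonneg (rho_dens h) r
  rw [div_le_iff₀ (by positivity)] at h1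
  have hF : 0 ≤ fieldSq g := integral_nonneg fun _ => sq_nonneg _
  refine abs_le_of_sq_le_sq' ?_ (by positivity) |>.2
  rw [mul_pow, mul_pow, Real.sq_sqrt hF, Real.sq_sqrt hr.le]
  nlinarith [Real.pi_le_four, mul_nonneg hF hr.le]

lemma phi_low {g : Phase → ℝ} (h : memErad g) (r : ℝ) (hr : 0 < r) :
    -(√(fieldSq g) / √r) ≤ phiRad g r := by
  have hd := rho_dens h
  set D := √(fieldSq g) with hD
  have hD0 : 0 ≤ D := Real.sqrt_nonneg _
  have hder : ∀ s, 0 < s → HasDerivAt (fun s => PD (rhoF g) s - 8 * D * (√s)⁻¹)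
      (-(mD (rhoF g) s / s ^ 2) - 8 * D * (-(1 / (2 * √s)) / (√s) ^ 2)) s := by
    intro s hs
    have h1 := ((Real.hasDerivAt_sqrt hs.ne').inv (Real.sqrt_pos.2 hs).ne').const_mul (8 * D)
    exact (PD_deriv hd s hs).sub h1
  have hmono : MonotoneOn (fun s => PD (rhoF g) s - 8 * D * (√s)⁻¹) (Ioi 0) := by
    refine monotoneOn_of_deriv_nonneg (convex_Ioi 0) (fun s hs => (hder s hs).continuousAt.continuousWithinAt) ?_ ?_
    · rw [interior_Ioi]
      exact fun s hs => (hder s hs).differentiableAt.differentiableWithinAt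
    · rw [interior_Ioi]
      intro s hs
      have hs : 0 < s := hs
      rw [(hder s hs).deriv]
      have hm := mD_bd h s hs
      have hq := Real.sqrt_pos.2 hs
      have e : s = √s ^ 2 := (Real.sq_sqrt hs.le).symm
      have : -(mD (rhoF g) s / s ^ 2) - 8 * D * (-(1 / (2 * √s)) / (√s) ^ 2) = (4 * D * √s - mD (rhoF g) s) / s ^ 2 := by
        have e4 : s ^ 2 = √s ^ 4 := by nth_rewrite 1 [e]; ring
        rw [e4]
        field_simp
        ring
      rw [this]
      exact div_nonneg (by linarith) (by positivity)
  have hle : PD (rhoF g) r - 8 * D * (√r)⁻¹ ≤ 0 := by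
    have ht : Tendsto (fun R : ℝ => (∫ y, rhoF g y) / R) atTop (𝓝 0) := tendsto_const_nhds.div_atTop tendsto_id
    refine ge_of_tendsto ht ?_
    filter_upwards [eventually_ge_atTop r] with R hR
    have hR0 : 0 < R := hr.trans_le hR
    have h1 := hmono (mem_Ioi.2 hr) (mem_Ioi.2 hR0) hR
    have h2 := PD_le hd R hR0
    have h3 : 0 ≤ 8 * D * (√R)⁻¹ := by positivity
    simp only at h1
    linarith
  rw [phiRad_eq h r hr, neg_le_neg_iff, div_le_iff₀ (by positivity)]
  have hx : 0 ≤ D / √r := by positivity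
  rw [← div_eq_mul_inv, mul_div_assoc] at hle
  nlinarith [Real.two_le_pi]

lemma aPot_meas {φ : ℝ → ℝ} (hφ : Measurable φ) : Measurable fun q : ℝ × ℝ => aPot φ q.1 q.2 := by
  have : Measurable fun q : (ℝ × ℝ) × ℝ => √(max (q.1.1 - psiPot φ q.1.2 q.2) 0) := by
    unfold psiPot; fun_prop
  exact (this.stronglyMeasurable.integral_prod_right' (ν := volume.restrict (Ioi (0:ℝ)))).measurable.const_mul _

lemma microE_meas {g : Phase → ℝ} (h : memErad g) : Measurable (microE g) := by
  have := phiF_meas h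
  unfold microE; fun_prop

lemma ellOf_meas : Measurable ellOf := by
  unfold ellOf; fun_prop

lemma rearr_meas {f g : Phase → ℝ} (hf : memErad f) (h : memErad g) : Measurable (rearr f g) := by
  have h1 := microE_meas h
  have h2 := ellOf_meas
  have h3 := aPot_meas (phiRad_meas h)
  have h4 := schwarz_meas f hf.meas
  have h5 : Measurable fun z => aPot (phiRad g) (microE g z) (ellOf z) :=
    Measurable.comp (g := fun q : ℝ × ℝ => aPot (phiRad g) q.1 q.2) (f := fun z => (microE g z, ellOf z)) h3 (h1.prodMk h2)
  have h6 : Measurable fun z => schwarz f (aPot (phiRad g) (microE g z) (ellOf z)) (ellOf z) :=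
    Measurable.comp (g := fun q : ℝ × ℝ => schwarz f q.1 q.2)
      (f := fun z => (aPot (phiRad g) (microE g z) (ellOf z), ellOf z)) h4 (h5.prodMk h2)
  have h7 : MeasurableSet {z | microE g z < 0} := measurableSet_lt h1 measurable_const
  unfold rearr
  exact Measurable.ite h7 h6 measurable_const

lemma rearr_nonneg (f g : Phase → ℝ) (z : Phase) : 0 ≤ rearr f g z := by
  unfold rearr
  split_ifs
  · exact schwarz_nonneg _ _ _
  · exact le_rfl

lemma rearr_sph {f g : Phase → ℝ} (h : memErad g) : SphSym (rearr f g) := by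
  intro R hR z
  have h1 : microE g (R z.1, R z.2) = microE g z := by
    unfold microE
    simp only [LinearIsometryEquiv.norm_map]
    rw [phiF_eq, potD_inv (rho_dens h) R hR]
  have h2 : ellOf (R z.1, R z.2) = ellOf z := by
    unfold ellOf
    simp only [LinearIsometryEquiv.norm_map, LinearIsometryEquiv.inner_map_map]
  unfold rearr
  rw [h1, h2]

lemma ess_bd {f : Phase → ℝ} (hf : memErad f) : volume {z | (eLpNorm f ⊤ volume).toReal < f z} = 0 := by
  have : ∀ᵐ z : Phase, ‖f z‖ₑ ≤ eLpNorm f ⊤ volume := by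
    have := ae_le_eLpNormEssSup (f := f) (μ := volume)
    simpa [eLpNorm_exponent_top] using this
  have h2 : ∀ᵐ z : Phase, ¬ (eLpNorm f ⊤ volume).toReal < f z := by
    filter_upwards [this] with z hz
    rw [not_lt, ← ENNReal.ofReal_le_iff_le_toReal hf.linf.ne, ← enorm_of_nonneg (hf.nonneg z)]
    exact hz
  simpa [ae_iff] using h2

lemma ae_mu {f : Phase → ℝ} (hf : memErad f) :
    ∀ᵐ ℓ ∂(volume.restrict (Ioi (0:ℝ))), muDist f (eLpNorm f ⊤ volume).toReal ℓ = 0 := by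
  have h1 := ess_bd hf
  rw [vol_eq f hf.meas hf.2, lintegral_eq_zero_iff (muDist_meas f hf.meas _)] at h1
  exact h1

lemma mu_rearr {f g : Phase → ℝ} (hf : memErad f) (h : memErad g) (hne : phiF g ≠ 0)
    {ℓ : ℝ} (hl : 0 < ℓ) {s s₀ : ℝ} (hs : 0 ≤ s) (h0 : muDist f s₀ ℓ = 0) :
    muDist (rearr f g) s ℓ = muDist f s ℓ := by
  obtain ⟨B, c, R, hG⟩ := good_pot h hne
  rw [muDist_eq _ (rearr_meas hf h) s ℓ hl.le]
  rw [← aPot_dist hG hl (muDist f s ℓ)]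
  congr 2
  ext p
  simp only [mem_ofPred_eq]
  refine and_congr_right fun hp => ?_
  have e1 : microE g (canon p.1 p.2 ℓ) = p.2 ^ 2 / 2 + psiPot (phiRad g) ℓ p.1 := by
    unfold microE psiPot
    rw [canon_snd_sq _ _ _ hl.le]
    have : phiF g (canon p.1 p.2 ℓ).1 = phiRad g p.1 := rfl
    rw [this]
    field_simp
    ring
  unfold rearr
  rw [e1, ellOf_canon _ _ _ hp hl.le]
  split_ifs with hneg
  · rw [lt_schwarz_iff f _ ℓ s s₀ h0 hs]
    simp [hneg]
  · simp [hneg, hs]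

lemma eqMeas_rearr {f g : Phase → ℝ} (hf : memErad f) (h : memErad g) (hne : phiF g ≠ 0) :
    EqMeas f (rearr f g) := by
  refine ⟨rearr_nonneg f g, rearr_sph h, fun s hs => ?_⟩
  filter_upwards [ae_mu hf, self_mem_ae_restrict measurableSet_Ioi] with ℓ h1 h2
  exact mu_rearr hf h hne h2 hs.le h1

lemma vol_rearr {f g : Phase → ℝ} (hf : memErad f) (h : memErad g) (hne : phiF g ≠ 0)
    (s : ℝ) (hs : 0 < s) : volume {z | s < rearr f g z} = volume {z | s < f z} := by
  rw [vol_eq _ (rearr_meas hf h) (rearr_sph h), vol_eq f hf.meas hf.2]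
  exact lintegral_congr_ae ((eqMeas_rearr hf h hne).2.2 s hs)

lemma eLp_eq {a b : Phase → ℝ} (ha : Measurable a) (hb : Measurable b) (ha0 : ∀ z, 0 ≤ a z)
    (hb0 : ∀ z, 0 ≤ b z) (hv : ∀ s, 0 < s → volume {z | s < a z} = volume {z | s < b z})
    (p : ℝ≥0∞) (hp : 1 ≤ p) : eLpNorm a p volume = eLpNorm b p volume := by
  by_cases hpt : p = ⊤
  · subst hpt
    have key : ∀ {a b : Phase → ℝ}, (∀ z, 0 ≤ a z) → (∀ z, 0 ≤ b z) →
        (∀ s, 0 < s → volume {z | s < a z} = volume {z | s < b z}) →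
        eLpNorm a ⊤ volume ≤ eLpNorm b ⊤ volume := by
      intro a b ha0 hb0 hv
      rw [eLpNorm_exponent_top, eLpNorm_exponent_top]
      refine le_of_forall_gt fun c hc => ?_
      obtain ⟨c', hc1, hc2⟩ := exists_between hc
      refine lt_of_le_of_lt ?_ hc2
      have hct : c' ≠ ⊤ := (hc2.trans_le le_top).ne
      have hpos : 0 < c'.toReal := ENNReal.toReal_pos (pos_of_gt hc1).ne' hct
      refine eLpNormEssSup_le_of_ae_enorm_bound ?_
      have h1 : ∀ᵐ z, ¬ (c'.toReal < b z) := by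
        filter_upwards [ae_le_eLpNormEssSup (f := b) (μ := volume)] with z hz
        rw [not_lt, ← ENNReal.ofReal_le_iff_le_toReal hct, ← enorm_of_nonneg (hb0 z)]
        exact hz.trans hc1.le
      have h2 : volume {z | c'.toReal < a z} = 0 := by
        rw [hv _ hpos]
        simpa [ae_iff] using h1
      have h3 : ∀ᵐ z, ¬ (c'.toReal < a z) := by
        simpa [ae_iff] using h2
      filter_upwards [h3] with z hz
      rw [not_lt, ← ENNReal.ofReal_le_iff_le_toReal hct, ← enorm_of_nonneg (ha0 z)] at hz
      exact hz
    exact le_antisymm (key ha0 hb0 hv) (key hb0 ha0 fun s hs => (hv s hs).symm)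
  · have hp0 : p ≠ 0 := (lt_of_lt_of_le one_pos hp).ne'
    have hpr : 0 < p.toReal := ENNReal.toReal_pos hp0 hpt
    rw [eLpNorm_eq_lintegral_rpow_enorm_toReal hp0 hpt, eLpNorm_eq_lintegral_rpow_enorm_toReal hp0 hpt]
    congr 1
    have conv : ∀ a : Phase → ℝ, (∀ z, 0 ≤ a z) → ∀ z, ‖a z‖ₑ ^ p.toReal = ENNReal.ofReal (a z ^ p.toReal) := by
      intro a ha z
      rw [enorm_of_nonneg (ha z), ENNReal.ofReal_rpow_of_nonneg (ha z) hpr.le]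
    rw [lintegral_congr (conv a ha0), lintegral_congr (conv b hb0),
      lintegral_rpow_eq_lintegral_meas_lt_mul _ (Eventually.of_forall ha0) ha.aemeasurable hpr,
      lintegral_rpow_eq_lintegral_meas_lt_mul _ (Eventually.of_forall hb0) hb.aemeasurable hpr]
    congr 1
    refine setLIntegral_congr_fun measurableSet_Ioi fun s hs => ?_
    rw [hv s hs]

lemma opt_bound (C0 D M N : ℝ) (hD : 0 < D) (hM : 0 < M) (hN : 0 < N) :
    ∃ L, 0 < L ∧ 2 * D / √L * M + C0 * N * D ^ ((5:ℝ)/2) * L ^ ((7:ℝ)/4) =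
      (2 + C0) * D ^ ((4:ℝ)/3) * M ^ ((7:ℝ)/9) * N ^ ((2:ℝ)/9) := by
  obtain ⟨d, rfl⟩ : ∃ d, D = exp d := ⟨log D, (Real.exp_log hD).symm⟩
  obtain ⟨m, rfl⟩ : ∃ d, M = exp d := ⟨log M, (Real.exp_log hM).symm⟩
  obtain ⟨n, rfl⟩ : ∃ d, N = exp d := ⟨log N, (Real.exp_log hN).symm⟩
  refine ⟨exp (4 / 9 * (m - n - 3 / 2 * d)), Real.exp_pos _, ?_⟩
  simp only [← Real.exp_mul, ← Real.exp_half]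
  have e1 : 2 * exp d / exp (4 / 9 * (m - n - 3 / 2 * d) / 2) * exp m =
      2 * (exp (d * (4/3)) * exp (m * (7/9)) * exp (n * (2/9))) := by
    rw [mul_div_assoc, ← Real.exp_sub, mul_assoc, ← Real.exp_add, ← Real.exp_add, ← Real.exp_add]
    congr 2; ring
  have e2 : C0 * exp n * exp (d * (5/2)) * exp (4 / 9 * (m - n - 3 / 2 * d) * (7/4)) =
      C0 * (exp (d * (4/3)) * exp (m * (7/9)) * exp (n * (2/9))) := by
    rw [mul_assoc, mul_assoc, ← Real.exp_add, ← Real.exp_add, ← Real.exp_add, ← Real.exp_add]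
    congr 2; ring
  rw [e1, e2]; ring

def C0 : ℝ := (volume (Metric.ball (0:E3) 1)).toReal * 2 ^ ((5:ℝ)/2) * (16 * π / 7)

lemma C0_nonneg : 0 ≤ C0 := by unfold C0; positivity

lemma phase_int (D L : ℝ) (hD : 0 ≤ D) (hL : 0 < L) :
    ∫⁻ z : Phase, {z : Phase | 0 < ‖z.1‖ ∧ ‖z.1‖ < L ∧ ‖z.2‖ ^ 2 < 2 * D / √‖z.1‖}.indicator
      (fun z => ENNReal.ofReal (‖z.2‖ ^ 2)) z ≤ ENNReal.ofReal (C0 * D ^ ((5:ℝ)/2) * L ^ ((7:ℝ)/4)) := by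
  set b := (volume (Metric.ball (0:E3) 1)) with hb
  have hbt : b ≠ ⊤ := measure_ball_lt_top.ne
  set A := {z : Phase | 0 < ‖z.1‖ ∧ ‖z.1‖ < L ∧ ‖z.2‖ ^ 2 < 2 * D / √‖z.1‖} with hA
  have hAm : MeasurableSet A := by
    have h1 : MeasurableSet {z : Phase | 0 < ‖z.1‖} := measurableSet_lt (by fun_prop) (by fun_prop)
    have h2 : MeasurableSet {z : Phase | ‖z.1‖ < L} := measurableSet_lt (by fun_prop) (by fun_prop)
    have h3 : MeasurableSet {z : Phase | ‖z.2‖ ^ 2 < 2 * D / √‖z.1‖} := measurableSet_lt (by fun_prop) (by fun_prop)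
    exact h1.inter (h2.inter h3)
  rw [Measure.volume_eq_prod, lintegral_prod _ (Measurable.aemeasurable (Measurable.indicator (by fun_prop) hAm))]
  set G : ℝ → ℝ≥0∞ := (Ioo 0 L).indicator fun s => ENNReal.ofReal ((2 * D) ^ ((5:ℝ)/2) * s ^ (-(5:ℝ)/4)) * b with hG
  have hGm : Measurable G := Measurable.indicator (by fun_prop) measurableSet_Ioo
  have h1 : ∀ x : E3, ∫⁻ v : E3, A.indicator (fun z => ENNReal.ofReal (‖z.2‖ ^ 2)) (x, v) ≤ G ‖x‖ := by
    intro x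
    by_cases hx : ‖x‖ ∈ Ioo 0 L
    · rw [hG, indicator_of_mem hx]
      have hx0 := hx.1
      set Q := 2 * D / √‖x‖ with hQ
      have hQ0 : 0 ≤ Q := by positivity
      have h2 : ∀ v : E3, A.indicator (fun z => ENNReal.ofReal (‖z.2‖ ^ 2)) (x, v) ≤
          (Metric.ball (0:E3) (√Q)).indicator (fun _ => ENNReal.ofReal Q) v := by
        intro v
        by_cases hv : (x, v) ∈ A
        · rw [indicator_of_mem hv, indicator_of_mem]
          · exact ENNReal.ofReal_le_ofReal hv.2.2.le
          · simp only [Metric.mem_ball, dist_zero_right]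
            exact Real.lt_sqrt_of_sq_lt hv.2.2
        · rw [indicator_of_notMem hv]; exact zero_le
      refine (lintegral_mono h2).trans ?_
      rw [lintegral_indicator measurableSet_ball, setLIntegral_const, Measure.addHaar_ball _ _ (Real.sqrt_nonneg Q), ← mul_assoc,
        ← ENNReal.ofReal_mul hQ0, ← hb]
      refine mul_le_mul_left (ENNReal.ofReal_le_ofReal (le_of_eq ?_)) _
      simp only [finrank_euclideanSpace, Fintype.card_fin]
      have e1 : Q * √Q ^ 3 = Q ^ ((5:ℝ)/2) := by
        rw [Real.sqrt_eq_rpow, ← Real.rpow_natCast, ← Real.rpow_mul hQ0]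
        nth_rewrite 1 [← Real.rpow_one Q]
        rw [← Real.rpow_add_of_nonneg hQ0 (by norm_num) (by norm_num)]
        norm_num
      rw [e1, hQ, Real.div_rpow (by positivity) (by positivity), Real.sqrt_eq_rpow, ← Real.rpow_mul hx0.le, div_eq_mul_inv, ← Real.rpow_neg hx0.le]
      norm_num
    · rw [hG, indicator_of_notMem hx, nonpos_iff_eq_zero]
      have : ∀ v : E3, A.indicator (fun z => ENNReal.ofReal (‖z.2‖ ^ 2)) (x, v) = 0 := fun v =>
        indicator_of_notMem (fun hv => hx ⟨hv.1, hv.2.1⟩) _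
      rw [lintegral_congr this, lintegral_zero]
  refine (lintegral_mono h1).trans ?_
  rw [lint_rad G hGm]
  have h3 : ∀ s, ENNReal.ofReal (s ^ 2) * G s = (Ioo 0 L).indicator (fun s => (ENNReal.ofReal ((2 * D) ^ ((5:ℝ)/2)) * b) * ENNReal.ofReal (s ^ ((3:ℝ)/4))) s := by
    intro s
    by_cases hs : s ∈ Ioo 0 L
    · rw [hG, indicator_of_mem hs, indicator_of_mem hs, ENNReal.ofReal_mul (by positivity)]
      have hs0 := hs.1
      have : ENNReal.ofReal (s ^ ((3:ℝ)/4)) = ENNReal.ofReal (s ^ 2) * ENNReal.ofReal (s ^ (-(5:ℝ)/4)) := by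
        rw [← ENNReal.ofReal_mul (by positivity), ← Real.rpow_two, ← Real.rpow_add hs0]
        norm_num
      rw [this]; ring
    · rw [hG, indicator_of_notMem hs, indicator_of_notMem hs, mul_zero]
  have h4 : ∫⁻ s in Ioo 0 L, ENNReal.ofReal (s ^ ((3:ℝ)/4)) = ENNReal.ofReal (4 / 7 * L ^ ((7:ℝ)/4)) := by
    have hi : IntervalIntegrable (fun s : ℝ => s ^ ((3:ℝ)/4)) volume 0 L := intervalIntegral.intervalIntegrable_rpow' (by norm_num)
    rw [setLIntegral_congr Ioo_ae_eq_Ioc, ← ofReal_integral_eq_lintegral_ofReal ((intervalIntegrable_iff_integrableOn_Ioc_of_le hL.le).1 hi),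
      ← intervalIntegral.integral_of_le hL.le, integral_rpow (Or.inl (by norm_num))]
    · congr 1
      rw [Real.zero_rpow (by norm_num)]
      norm_num
      ring
    · filter_upwards [self_mem_ae_restrict measurableSet_Ioc] with s hs
      exact Real.rpow_nonneg hs.1.le _
  have h5 : ∫⁻ s in Ioi (0:ℝ), ENNReal.ofReal (s ^ 2) * G s = (ENNReal.ofReal ((2 * D) ^ ((5:ℝ)/2)) * b) * ENNReal.ofReal (4 / 7 * L ^ ((7:ℝ)/4)) := by
    simp_rw [h3]
    rw [setLIntegral_indicator measurableSet_Ioo, inter_eq_left.2 Ioo_subset_Ioi_self, lintegral_const_mul' _ _ (ENNReal.mul_ne_top ENNReal.ofReal_ne_top hbt), h4]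
  rw [h5, ← ENNReal.ofReal_toReal hbt, ← ENNReal.ofReal_mul (by positivity), ← ENNReal.ofReal_mul (by positivity), ← ENNReal.ofReal_mul (by positivity)]
  refine ENNReal.ofReal_le_ofReal (le_of_eq ?_)
  unfold C0
  rw [Real.mul_rpow (by norm_num) hD, ← hb]
  ring

lemma mass_rearr {f g : Phase → ℝ} (hf : memErad f)
    (hL : ∀ p : ℝ≥0∞, 1 ≤ p → eLpNorm (rearr f g) p volume = eLpNorm f p volume) :
    ∫⁻ z, ENNReal.ofReal (rearr f g z) = ENNReal.ofReal (mass f) := by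
  have h1 := hL 1 le_rfl
  rw [eLpNorm_one_eq_lintegral_enorm, eLpNorm_one_eq_lintegral_enorm] at h1
  unfold mass
  rw [ofReal_integral_eq_lintegral_ofReal hf.int (Eventually.of_forall hf.nonneg)]
  rw [lintegral_congr fun z => (enorm_of_nonneg (rearr_nonneg f g z)).symm, h1]
  exact lintegral_congr fun z => enorm_of_nonneg (hf.nonneg z)

lemma ae_ne_zero : ∀ᵐ z : Phase, z.1 ≠ 0 := by
  have h : ∀ᵐ x : E3, x ≠ 0 := compl_mem_ae_iff.2 (measure_singleton (0:E3))
  exact Measure.quasiMeasurePreserving_fst.ae h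

lemma kin_bound {f g : Phase → ℝ} (hf : memErad f) (h : memErad g)
    (hLp : ∀ p : ℝ≥0∞, 1 ≤ p → eLpNorm (rearr f g) p volume = eLpNorm f p volume) (L : ℝ) (hL : 0 < L) :
    ∫⁻ z : Phase, ENNReal.ofReal (‖z.2‖ ^ 2 * rearr f g z) ≤
      ENNReal.ofReal (2 * √(fieldSq g) / √L * mass f + C0 * (eLpNorm f ⊤ volume).toReal * √(fieldSq g) ^ ((5:ℝ)/2) * L ^ ((7:ℝ)/4)) := by
  set D := √(fieldSq g) with hD
  have hD0 : 0 ≤ D := Real.sqrt_nonneg _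
  set N := (eLpNorm f ⊤ volume).toReal with hN
  have hN0 : 0 ≤ N := ENNReal.toReal_nonneg
  have hM0 : 0 ≤ mass f := integral_nonneg hf.nonneg
  have hC := C0_nonneg
  have hb : ∀ᵐ z : Phase, rearr f g z ≤ N := by
    have := ae_le_eLpNormEssSup (f := rearr f g) (μ := volume)
    rw [← eLpNorm_exponent_top, hLp ⊤ le_top] at this
    filter_upwards [this] with z hz
    rw [enorm_of_nonneg (rearr_nonneg f g z), ENNReal.ofReal_le_iff_le_toReal hf.linf.ne] at hz
    exact hz
  have hrm := rearr_meas hf h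
  have hpt : ∀ᵐ z : Phase, ENNReal.ofReal (‖z.2‖ ^ 2 * rearr f g z) ≤ ENNReal.ofReal (2 * D / √L) * ENNReal.ofReal (rearr f g z)
      + ENNReal.ofReal N * {z : Phase | 0 < ‖z.1‖ ∧ ‖z.1‖ < L ∧ ‖z.2‖ ^ 2 < 2 * D / √‖z.1‖}.indicator
      (fun z => ENNReal.ofReal (‖z.2‖ ^ 2)) z := by
    filter_upwards [hb, ae_ne_zero] with z hz hz0
    have hx : 0 < ‖z.1‖ := norm_pos_iff.2 hz0
    by_cases hE : microE g z < 0
    · have h1 : ‖z.2‖ ^ 2 < 2 * D / √‖z.1‖ := by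
        unfold microE at hE
        rw [phiF_rad h] at hE
        have := phi_low h ‖z.1‖ hx
        rw [mul_div_assoc]
        linarith
      by_cases hxL : ‖z.1‖ < L
      · refine le_trans ?_ le_add_self
        rw [indicator_of_mem (show z ∈ {z : Phase | 0 < ‖z.1‖ ∧ ‖z.1‖ < L ∧ ‖z.2‖ ^ 2 < 2 * D / √‖z.1‖} from ⟨hx, hxL, h1⟩), ← ENNReal.ofReal_mul hN0, mul_comm]
        exact ENNReal.ofReal_le_ofReal (mul_le_mul_of_nonneg_right hz (by positivity))
      · refine le_trans ?_ le_self_add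
        rw [← ENNReal.ofReal_mul (by positivity)]
        refine ENNReal.ofReal_le_ofReal (mul_le_mul_of_nonneg_right (h1.le.trans ?_) (rearr_nonneg _ _ _))
        exact div_le_div_of_nonneg_left (by positivity) (Real.sqrt_pos.2 hL) (Real.sqrt_le_sqrt (not_lt.1 hxL))
    · have : rearr f g z = 0 := by unfold rearr; rw [if_neg hE]
      rw [this, mul_zero, ENNReal.ofReal_zero]; exact zero_le
  refine (lintegral_mono_ae hpt).trans ?_
  rw [lintegral_add_left (by fun_prop), lintegral_const_mul' _ _ (by simp), lintegral_const_mul' _ _ (by simp), mass_rearr hf hLp,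
    ENNReal.ofReal_add (by positivity) (by positivity), ← ENNReal.ofReal_mul (by positivity)]
  refine add_le_add le_rfl ?_
  refine (mul_le_mul_right (phase_int D L hD0 hL) _).trans ?_
  rw [← ENNReal.ofReal_mul hN0]
  refine ENNReal.ofReal_le_ofReal (le_of_eq (by ring))

lemma kin_final {f g : Phase → ℝ} (hf : memErad f) (h : memErad g)
    (hLp : ∀ p : ℝ≥0∞, 1 ≤ p → eLpNorm (rearr f g) p volume = eLpNorm f p volume) :
    ∫⁻ z : Phase, ENNReal.ofReal (‖z.2‖ ^ 2 * rearr f g z) ≤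
      ENNReal.ofReal ((2 + C0) * √(fieldSq g) ^ ((4:ℝ)/3) * (mass f) ^ ((7:ℝ)/9) * (eLpNorm f ⊤ volume).toReal ^ ((2:ℝ)/9)) := by
  have hM0 : 0 ≤ mass f := integral_nonneg hf.nonneg
  rcases (Real.sqrt_nonneg (fieldSq g)).eq_or_lt with hD | hD
  · have := kin_bound hf h hLp 1 one_pos
    rw [← hD] at this ⊢
    rw [Real.zero_rpow (by norm_num)] at this ⊢
    simpa using this
  have hz : (∫⁻ z, ENNReal.ofReal (rearr f g z) = 0) → ∫⁻ z : Phase, ENNReal.ofReal (‖z.2‖ ^ 2 * rearr f g z) = 0 := by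
    intro h0
    have hrm := rearr_meas hf h
    rw [lintegral_eq_zero_iff (by fun_prop)] at h0
    rw [lintegral_eq_zero_iff (by fun_prop)]
    filter_upwards [h0] with z hz
    have : rearr f g z = 0 := le_antisymm (ENNReal.ofReal_eq_zero.1 hz) (rearr_nonneg _ _ _)
    simp [this]
  rcases hM0.eq_or_lt with hM | hM
  · rw [hz (by rw [mass_rearr hf hLp, ← hM, ENNReal.ofReal_zero])]; exact zero_le
  rcases (ENNReal.toReal_nonneg (a := eLpNorm f ⊤ volume)).eq_or_lt with hN | hN
  · exfalso
    have : eLpNorm f ⊤ volume = 0 := ((ENNReal.toReal_eq_zero_iff _).1 hN.symm).resolve_right hf.linf.ne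
    rw [eLpNorm_eq_zero_iff hf.meas.aestronglyMeasurable (by simp)] at this
    have h2 : mass f = 0 := by unfold mass; exact integral_eq_zero_of_ae this
    linarith
  obtain ⟨L, hL, hE⟩ := opt_bound C0 _ _ _ hD hM hN
  rw [← hE]
  exact kin_bound hf h hLp L hL

/-- The rearrangement `f^{*φ}` is equimeasurable to `f`, belongs to `E_rad`, and its
kinetic energy is controlled by the field of `φ`. -/
theorem stmt13 :
    ∃ C : ℝ, 0 < C ∧
      ∀ f g : Phase → ℝ, memErad f → memErad g → phiF g ≠ 0 →
        EqMeas f (rearr f g) ∧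
        (∀ p : ℝ≥0∞, 1 ≤ p → eLpNorm (rearr f g) p volume = eLpNorm f p volume) ∧
        memErad (rearr f g) ∧
        (∫ z : Phase, ‖z.2‖ ^ 2 * rearr f g z) ≤
          C * (Real.sqrt (fieldSq g)) ^ ((4:ℝ)/3) * (mass f) ^ ((7:ℝ)/9) *
            ((eLpNorm f ⊤ volume).toReal) ^ ((2:ℝ)/9) := by
  refine ⟨2 + C0, by linarith [C0_nonneg], fun f g hf hg hne => ?_⟩
  have hrm := rearr_meas hf hg
  have hLp : ∀ p : ℝ≥0∞, 1 ≤ p → eLpNorm (rearr f g) p volume = eLpNorm f p volume :=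
    eLp_eq hrm hf.meas (rearr_nonneg f g) hf.nonneg (vol_rearr hf hg hne)
  have hk := kin_final hf hg hLp
  have hM0 : 0 ≤ mass f := integral_nonneg hf.nonneg
  refine ⟨eqMeas_rearr hf hg hne, hLp, ⟨⟨hrm, rearr_nonneg f g, ?_⟩, rearr_sph hg⟩, ?_⟩
  · unfold eNormE
    rw [hLp 1 le_rfl, hLp ⊤ le_top]
    refine ENNReal.add_lt_top.2 ⟨ENNReal.add_lt_top.2 ⟨hf.l1, hf.linf⟩, ?_⟩
    refine lt_of_le_of_lt (le_of_eq ?_) (lt_of_le_of_lt hk ENNReal.ofReal_lt_top)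
    refine lintegral_congr fun z => ?_
    rw [ENNReal.ofReal_mul (by positivity), ENNReal.ofReal_pow (norm_nonneg _), ofReal_norm, ← enorm_of_nonneg (rearr_nonneg f g z)]
    rfl
  · rw [integral_eq_lintegral_of_nonneg_ae (Eventually.of_forall fun z => mul_nonneg (by positivity) (rearr_nonneg f g z))
      (Measurable.aestronglyMeasurable (by fun_prop))]
    refine ENNReal.toReal_le_of_le_ofReal ?_ hk
    have := C0_nonneg
    positivity
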